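/- arXiv:1310.7654 — 2 statements merged into one kernel-verified Lean document; each statement's English description precedes it below -/
import Mathlib

section
/- Every n-player m-action game admits a product distribution (s_i)_{i∈[n]} in which every s_i is a k-uniform distribution on [m] and which is an ε-Nash equilibrium, for every ε ∈ (0,1) and every integer k > 8(ln m + ln n − ln ε + ln 8)/ε². -/
open Finset

open scoped Classical

noncomputable section

/-- `x` is a probability distribution on the finite type `A`. -/
def IsDist {A : Type*} [Fintype A] (x : A → ℝ) : Prop :=
  (∀ a, 0 ≤ x a) ∧ ∑ a, x a = 1

/-- Probability of the pure action profile `a` under the product distribution `x`. -/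
def prodProb {n m : ℕ} (x : Fin n → Fin m → ℝ) (a : Fin n → Fin m) : ℝ :=
  ∏ i, x i (a i)

/-- Expected utility of the payoff function `u` under the product distribution `x`. -/
def EU {n m : ℕ} (u : (Fin n → Fin m) → ℝ) (x : Fin n → Fin m → ℝ) : ℝ :=
  ∑ a, prodProb x a * u a

/-- The point mass (pure strategy) at action `b`. -/
def pureStrat {m : ℕ} (b : Fin m) : Fin m → ℝ := fun c => if c = b then 1 else 0

/-- `x` is an `ε`-Nash equilibrium of the game `u`: no player gains more than `ε`
by deviating to any pure action. -/
def IsNash {n m : ℕ} (u : Fin n → (Fin n → Fin m) → ℝ) (x : Fin n → Fin m → ℝ)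
    (ε : ℝ) : Prop :=
  ∀ (i : Fin n) (b : Fin m),
    EU (u i) x ≥ EU (u i) (Function.update x i (pureStrat b)) - ε

/-- Empirical distribution of player `i` given `k` sampled action profiles. -/
def emp {n m : ℕ} (k : ℕ) (a : Fin k → Fin n → Fin m) (i : Fin n) : Fin m → ℝ :=
  fun b => ((univ.filter fun t => a t i = b).card : ℝ) / k

/-- Probability of the event `E` over `k` i.i.d. samples from the product distribution `x`. -/
def PrProd {n m : ℕ} (k : ℕ) (x : Fin n → Fin m → ℝ)
    (E : (Fin k → Fin n → Fin m) → Prop) : ℝ :=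
  ∑ a : Fin k → Fin n → Fin m, if E a then ∏ t, prodProb x (a t) else 0

/-- A distribution on a finite set is `k`-uniform if every probability is an integer
multiple of `1/k` (equivalently, it is uniform over a size-`k` multiset). -/
def IsKUniform {A : Type*} [Fintype A] (k : ℕ) (x : A → ℝ) : Prop :=
  ∀ a, ∃ c : ℕ, x a = (c : ℝ) / k

/-- `P` dominates `V` with respect to the family of orders `f`: every `v` lies weakly below all of
`P` in at least one of the orders. -/
def Dominant {I V α : Type*} [LinearOrder α] (f : I → V → α) (P : Finset V) : Prop :=
  ∀ v, ∃ i, ∀ p ∈ P, f i v ≤ f i p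

theorem Dominant.subset {I V α : Type*} [LinearOrder α] {f : I → V → α} {P Q : Finset V}
    (h : Dominant f P) (hQ : Q ⊆ P) : Dominant f Q := fun v =>
  let ⟨i, hi⟩ := h v
  ⟨i, fun p hp => hi p (hQ hp)⟩

/-- A door without interior point is contained in exactly one room. -/
theorem card_rooms_boundary {I V α : Type*} [Fintype I] [Fintype V] [LinearOrder α]
    {f : I → V → α} (hf : ∀ i, Function.Injective (f i)) {e : I → V}
    (he : Function.Injective e)
    (hmin : ∀ i v, f i (e i) ≤ f i v)
    (hmax : ∀ i j v, i ≠ j → v ∉ Set.range e → f i v < f i (e j))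
    (hne : ∃ v, v ∉ Set.range e) (i₀ : I) :
    #{P : Finset V | (#P = Fintype.card I ∧ Dominant f P) ∧ (univ.erase i₀).image e ⊆ P} = 1 := by
  obtain ⟨x, hx, hxm⟩ := Finset.exists_max_image ({v | v ∉ Set.range e} : Finset V) (f i₀)
    (by obtain ⟨v, hv⟩ := hne; exact ⟨v, by simpa using hv⟩)
  simp only [mem_filter, mem_univ, true_and] at hx hxm
  set Q := (univ.erase i₀).image e with hQ
  have hQc : #Q + 1 = Fintype.card I := by
    rw [hQ, card_image_of_injective _ he, card_erase_of_mem (mem_univ _), card_univ]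
    have : 0 < Fintype.card I := Fintype.card_pos_iff.2 ⟨i₀⟩
    omega
  have hxQ : x ∉ Q := by
    intro h
    obtain ⟨j, -, rfl⟩ := mem_image.1 h
    exact hx ⟨j, rfl⟩
  have heQ : ∀ l, l ≠ i₀ → e l ∈ Q := fun l hl => mem_image_of_mem _ (by simp [hl])
  rw [card_eq_one]
  refine ⟨insert x Q, ?_⟩
  ext P
  simp only [mem_filter, mem_univ, true_and, mem_singleton]
  constructor
  · rintro ⟨⟨hc, hd⟩, hs⟩
    obtain ⟨y, hy, rfl⟩ : ∃ y, y ∉ Q ∧ insert y Q = P := by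
      rw [← Finset.covBy_iff_exists_insert]
      exact Finset.covBy_iff_card_sdiff_eq_one.2 ⟨hs, by rw [card_sdiff_of_subset hs]; omega⟩
    have key : ∀ v, v ∉ Set.range e → f i₀ v ≤ f i₀ y := by
      intro v hv
      obtain ⟨l, hl⟩ := hd v
      have : l = i₀ := by
        by_contra h
        have h1 := hl (e l) (mem_insert_of_mem (heQ l h))
        have h2 := hf l (le_antisymm h1 (hmin l v))
        exact hv ⟨l, h2.symm⟩
      subst this
      exact hl y (mem_insert_self _ _)
    have hyr : y ∉ Set.range e := by
      rintro ⟨j, rfl⟩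
      by_cases hj : j = i₀
      · subst hj
        exact hx ⟨j, (hf j (le_antisymm (key x hx) (hmin j x))).symm⟩
      · exact hy (heQ j hj)
    rw [hf i₀ (le_antisymm (hxm y hyr) (key x hx))]
  · rintro rfl
    refine ⟨⟨by rw [card_insert_of_notMem hxQ, hQc], fun v => ?_⟩, subset_insert _ _⟩
    by_cases hv : v ∈ Set.range e
    · obtain ⟨j, rfl⟩ := hv
      exact ⟨j, fun p _ => hmin j p⟩
    · refine ⟨i₀, fun p hp => ?_⟩
      rcases mem_insert.1 hp with rfl | hp
      · exact hxm v hv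
      · obtain ⟨j, hj, rfl⟩ := mem_image.1 hp
        exact (hmax i₀ j v (by simpa [eq_comm] using hj) hv).le

/-- A door with an interior point is contained in exactly two rooms. -/
theorem card_rooms_interior {I V α : Type*} [Fintype I] [Fintype V] [LinearOrder α]
    {f : I → V → α} (hf : ∀ i, Function.Injective (f i)) {e : I → V}
    (hmax : ∀ i j v, i ≠ j → v ∉ Set.range e → f i v < f i (e j))
    {Q : Finset V} (hQc : #Q + 1 = Fintype.card I) (hQ : Dominant f Q)
    (hne : ∃ v ∈ Q, v ∉ Set.range e) :
    #{P : Finset V | (#P = Fintype.card I ∧ Dominant f P) ∧ Q ⊆ P} = 2 := by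
  obtain ⟨t, htQ, ht⟩ := hne
  choose M hMQ hM using fun l => Finset.exists_min_image Q (f l) ⟨t, htQ⟩
  have hMeq : ∀ l q, q ∈ Q → (∀ p ∈ Q, f l q ≤ f l p) → M l = q := fun l q hq h =>
    hf l (le_antisymm (hM l q hq) (h _ (hMQ l)))
  obtain ⟨i, j, hij, hMij⟩ : ∃ i j, i ≠ j ∧ M i = M j := by
    obtain ⟨i, -, j, -, h, h'⟩ := Finset.exists_ne_map_eq_of_card_lt_of_maps_to
      (s := univ) (t := Q) (f := M) (by rw [card_univ]; omega) (fun l _ => hMQ l)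
    exact ⟨i, j, h, h'⟩
  have hsmall : ∀ s : Finset I, #s + 1 < Fintype.card I → ¬ ∀ q ∈ Q, ∃ l ∈ s, M l = q := by
    intro s hs h
    have : Q ⊆ s.image M := fun q hq => mem_image.2 (h q hq)
    have := (card_le_card this).trans card_image_le
    omega
  have herase2 : ∀ k l : I, k ≠ l → #((univ.erase k).erase l) + 1 < Fintype.card I := by
    intro k l hkl
    have h1 : #((univ.erase k).erase l) + 1 = #(univ.erase k) :=
      card_erase_add_one (by simp [hkl.symm])
    have h2 : #(univ.erase k) + 1 = Fintype.card I := card_erase_add_one (mem_univ _)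
    omega
  have hsurj : ∀ k, k = i ∨ k = j → ∀ q ∈ Q, ∃ l, l ≠ k ∧ M l = q := by
    intro k hk q hq
    obtain ⟨l, hl⟩ := hQ q
    have hlq := hMeq l q hq hl
    by_cases hlk : l = k
    · rcases hk with rfl | rfl
      · exact ⟨j, hij.symm, by rw [← hMij, ← hlk, hlq]⟩
      · exact ⟨i, hij, by rw [hMij, ← hlk, hlq]⟩
    · exact ⟨l, hlk, hlq⟩
  have hpair : ∀ k, (∀ q ∈ Q, ∃ l, l ≠ k ∧ M l = q) → k = i ∨ k = j := by
    intro k hk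
    by_contra! h
    refine hsmall _ (herase2 k i h.1) fun q hq => ?_
    obtain ⟨l, hl, hlq⟩ := hk q hq
    by_cases hli : l = i
    · exact ⟨j, by simp [hij.symm, h.2.symm], by rw [← hMij, ← hli, hlq]⟩
    · exact ⟨l, by simp [hl, hli], hlq⟩
  have hex : ∀ k, ∃ x, (∀ l, l ≠ k → f l (M l) < f l x) ∧
      ∀ y, (∀ l, l ≠ k → f l (M l) < f l y) → f k y ≤ f k x := by
    intro k
    obtain ⟨x, hx, hxm⟩ := Finset.exists_max_image
      ({y | ∀ l, l ≠ k → f l (M l) < f l y} : Finset V) (f k)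
      ⟨e k, by
        simp only [mem_filter, mem_univ, true_and]
        exact fun l hl => (hM l t htQ).trans_lt (hmax l k t hl ht)⟩
    simp only [mem_filter, mem_univ, true_and] at hx hxm
    exact ⟨x, hx, hxm⟩
  choose x hx hxm using hex
  have hxQ : ∀ k, k = i ∨ k = j → x k ∉ Q := by
    intro k hk h
    obtain ⟨l, hl, hlq⟩ := hsurj k hk _ h
    have := hx k l hl
    rw [hlq] at this
    exact lt_irrefl _ this
  have hxij : x i ≠ x j := by
    intro h
    obtain ⟨l, hl⟩ := hQ (x i)
    refine absurd (hl _ (hMQ l)) (not_le.2 ?_)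
    by_cases hli : l = i
    · rw [h]
      exact hx j l (by rw [hli]; exact hij)
    · exact hx i l hli
  have hroom : ∀ k, k = i ∨ k = j →
      ((#(insert (x k) Q) = Fintype.card I ∧ Dominant f (insert (x k) Q)) ∧
        Q ⊆ insert (x k) Q) := by
    intro k hk
    refine ⟨⟨by rw [card_insert_of_notMem (hxQ k hk), hQc], fun v => ?_⟩, subset_insert _ _⟩
    by_cases hv : ∀ l, l ≠ k → f l (M l) < f l v
    · refine ⟨k, fun p hp => ?_⟩
      have h1 := hxm k v hv
      rcases mem_insert.1 hp with rfl | hpQ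
      · exact h1
      · obtain ⟨l, hl⟩ := hQ (x k)
        have : l = k := by
          by_contra h
          exact absurd (hl _ (hMQ l)) (not_le.2 (hx k l h))
        subst this
        exact h1.trans (hl p hpQ)
    · push Not at hv
      obtain ⟨l, hl, hvl⟩ := hv
      refine ⟨l, fun p hp => ?_⟩
      rcases mem_insert.1 hp with rfl | hp
      · exact hvl.trans (hx k l hl).le
      · exact hvl.trans (hM l p hp)
  rw [card_eq_two]
  refine ⟨insert (x i) Q, insert (x j) Q, fun h => ?_, ?_⟩
  · have : x i ∈ insert (x j) Q := h ▸ mem_insert_self _ _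
    rcases mem_insert.1 this with h | h
    · exact hxij h
    · exact hxQ i (Or.inl rfl) h
  ext P
  simp only [mem_filter, mem_univ, true_and, mem_singleton, mem_insert]
  constructor
  · rintro ⟨⟨hc, hd⟩, hs⟩
    obtain ⟨y, hy, rfl⟩ : ∃ y, y ∉ Q ∧ insert y Q = P := by
      rw [← Finset.covBy_iff_exists_insert]
      exact Finset.covBy_iff_card_sdiff_eq_one.2 ⟨hs, by rw [card_sdiff_of_subset hs]; omega⟩
    have hq : ∀ q ∈ Q, ∃ l, M l = q ∧ f l q < f l y := by
      intro q hq
      obtain ⟨l, hl⟩ := hd q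
      refine ⟨l, hMeq l q hq fun p hp => hl p (mem_insert_of_mem hp),
        lt_of_le_of_ne (hl y (mem_insert_self _ _)) fun h => ?_⟩
      exact hy (hf l h ▸ hq)
    obtain ⟨k, hk⟩ := hd y
    have hne_of : ∀ k, (∀ p ∈ insert y Q, f k y ≤ f k p) → ∀ q ∈ Q, ∀ l,
        M l = q → f l q < f l y → l ≠ k := by
      rintro k hk q hq l - h rfl
      exact absurd h (not_lt.2 (hk q (mem_insert_of_mem hq)))
    have hkij : k = i ∨ k = j := hpair k fun q hqQ => by
      obtain ⟨l, hl, hlt⟩ := hq q hqQ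
      exact ⟨l, hne_of k hk q hqQ l hl hlt, hl⟩
    have hyS : ∀ l, l ≠ k → f l (M l) < f l y := by
      intro l hlk
      by_contra! h
      have hl : ∀ p ∈ insert y Q, f l y ≤ f l p := by
        intro p hp
        rcases mem_insert.1 hp with rfl | hp
        · exact le_rfl
        · exact h.trans (hM l p hp)
      refine hsmall _ (herase2 k l hlk.symm) fun q hqQ => ?_
      obtain ⟨l', hl', hlt⟩ := hq q hqQ
      exact ⟨l', by simp [hne_of k hk q hqQ l' hl' hlt, hne_of l hl q hqQ l' hl' hlt], hl'⟩
    have hyx : y = x k := by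
      refine hf k (le_antisymm (hxm k y hyS) ?_)
      obtain ⟨l, hl⟩ := hd (x k)
      have : l = k := by
        by_contra h
        exact absurd (hl _ (mem_insert_of_mem (hMQ l))) (not_le.2 (hx k l h))
      subst this
      exact hl y (mem_insert_self _ _)
    rcases hkij with h | h
    · left; rw [hyx, h]
    · right; rw [hyx, h]
  · rintro (rfl | rfl)
    · exact hroom i (Or.inl rfl)
    · exact hroom j (Or.inr rfl)

/-- A set that does not carry all colors has an even number of facets carrying exactly the colors
other than `i₀`. -/
theorem even_card_facets {I V : Type*} [Fintype I] [Fintype V] (c : V → I) (i₀ : I)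
    {P : Finset V} (hP : #P = Fintype.card I) (hc : ¬ ∀ i, ∃ p ∈ P, c p = i) :
    Even #{Q : Finset V | (#Q + 1 = Fintype.card I ∧ Q.image c = univ.erase i₀) ∧ Q ⊆ P} := by
  rcases Finset.eq_empty_or_nonempty
    ({Q : Finset V | (#Q + 1 = Fintype.card I ∧ Q.image c = univ.erase i₀) ∧ Q ⊆ P} :
      Finset (Finset V)) with h | ⟨Q, hQ⟩
  · rw [h]; simp
  simp only [mem_filter, mem_univ, true_and] at hQ
  obtain ⟨⟨hQc, hQi⟩, hQP⟩ := hQ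
  obtain ⟨x, hx, rfl⟩ : ∃ y, y ∉ Q ∧ insert y Q = P := by
    rw [← Finset.covBy_iff_exists_insert]
    exact Finset.covBy_iff_card_sdiff_eq_one.2 ⟨hQP, by rw [card_sdiff_of_subset hQP]; omega⟩
  have hcol : ∀ i, i ≠ i₀ → ∃ q ∈ Q, c q = i := fun i hi =>
    mem_image.1 (hQi ▸ mem_erase.2 ⟨hi, mem_univ i⟩)
  have hcx : c x ≠ i₀ := by
    intro h
    refine hc fun i => ?_
    by_cases hi : i = i₀
    · exact ⟨x, mem_insert_self _ _, h.trans hi.symm⟩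
    · obtain ⟨q, hq, hqi⟩ := hcol i hi
      exact ⟨q, mem_insert_of_mem hq, hqi⟩
  obtain ⟨y, hy, hyx⟩ := hcol _ hcx
  have hxy : x ≠ y := fun h => hx (h ▸ hy)
  have hinj : Set.InjOn c Q := by
    rw [← Finset.card_image_iff, hQi, card_erase_of_mem (mem_univ _), card_univ]
    omega
  have hQx : (insert x Q).erase x = Q := erase_insert hx
  have hcard : ∀ z ∈ insert x Q, #((insert x Q).erase z) + 1 = Fintype.card I := fun z hz => by
    rw [card_erase_add_one hz, hP]
  have : #{Q' : Finset V | (#Q' + 1 = Fintype.card I ∧ Q'.image c = univ.erase i₀) ∧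
      Q' ⊆ insert x Q} = 2 := by
    rw [card_eq_two]
    refine ⟨(insert x Q).erase x, (insert x Q).erase y, fun h => ?_, ?_⟩
    · have : y ∈ (insert x Q).erase x := by rw [hQx]; exact hy
      rw [h] at this
      simp at this
    ext Q'
    simp only [mem_filter, mem_univ, true_and, mem_singleton, mem_insert]
    constructor
    · rintro ⟨⟨h1, h2⟩, h3⟩
      obtain ⟨z, hz, hzQ⟩ : ∃ z, z ∉ Q' ∧ insert z Q' = insert x Q := by
        rw [← Finset.covBy_iff_exists_insert]
        exact Finset.covBy_iff_card_sdiff_eq_one.2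
          ⟨h3, by rw [card_sdiff_of_subset h3]; omega⟩
      have hQ' : Q' = (insert x Q).erase z := by rw [← hzQ, erase_insert hz]
      by_cases hzx : z = x
      · left; rw [hQ', hzx]
      right
      have hzQ2 : z ∈ Q := by
        have : z ∈ insert x Q := hzQ ▸ mem_insert_self _ _
        exact (mem_insert.1 this).resolve_left hzx
      have hcz : c z ≠ i₀ := by
        have : c z ∈ Q.image c := mem_image_of_mem _ hzQ2
        rw [hQi] at this
        exact (mem_erase.1 this).1
      have : c z ∈ Q'.image c := by rw [h2]; simp [hcz]
      obtain ⟨w, hw, hwz⟩ := mem_image.1 this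
      have hwne : w ≠ z := fun h => hz (h ▸ hw)
      rcases mem_insert.1 (h3 hw) with rfl | hwQ
      · rw [hQ', hinj hzQ2 hy (hwz.symm.trans hyx.symm)]
      · exact absurd (hinj hwQ hzQ2 hwz) hwne
    · rintro (rfl | rfl)
      · rw [hQx]
        exact ⟨⟨hQc, hQi⟩, subset_insert _ _⟩
      · refine ⟨⟨hcard y (mem_insert_of_mem hy), ?_⟩, erase_subset _ _⟩
        rw [← hQi]
        ext i
        simp only [mem_image, mem_erase, mem_insert]
        constructor
        · rintro ⟨w, ⟨hwy, rfl | hw⟩, rfl⟩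
          · exact ⟨y, hy, hyx⟩
          · exact ⟨w, hw, rfl⟩
        · rintro ⟨w, hw, rfl⟩
          by_cases hwy : w = y
          · exact ⟨x, ⟨hxy, Or.inl rfl⟩, by rw [hwy, hyx]⟩
          · exact ⟨w, ⟨hwy, Or.inr hw⟩, rfl⟩
  rw [this]
  exact even_two

/-- **Scarf's lemma**: a colored finite set with one linear order for each color, each order having
its own minimal slack element `e i`, contains a dominant set carrying each color exactly once. -/
theorem exists_colorful_dominant {I V α : Type*} [Fintype I] [Nonempty I] [Fintype V]
    [LinearOrder α] {f : I → V → α} (hf : ∀ i, Function.Injective (f i)) {e : I → V}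
    (hmin : ∀ i v, f i (e i) ≤ f i v)
    (hmax : ∀ i j v, i ≠ j → v ∉ Set.range e → f i v < f i (e j))
    (hne : ∃ v, v ∉ Set.range e) (c : V → I) (hce : ∀ i, c (e i) = i) :
    ∃ P : Finset V, #P = Fintype.card I ∧ Dominant f P ∧ ∀ i, ∃ p ∈ P, c p = i := by
  by_contra! hcon
  have he : Function.Injective e := Function.LeftInverse.injective hce
  obtain ⟨i₀⟩ := ‹Nonempty I›
  let R : Finset (Finset V) := {P | #P = Fintype.card I ∧ Dominant f P}
  let D : Finset (Finset V) :=
    {Q | (#Q + 1 = Fintype.card I ∧ Q.image c = univ.erase i₀) ∧ Dominant f Q}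
  have hcount := Finset.sum_card_bipartiteAbove_eq_sum_card_bipartiteBelow
    (s := R) (t := D) (fun P Q => Q ⊆ P)
  have hL : Even (∑ P ∈ R, #(bipartiteAbove (fun P Q : Finset V => Q ⊆ P) D P)) := by
    refine Finset.even_sum _ fun P hP => ?_
    simp only [R, mem_filter, mem_univ, true_and] at hP
    have : bipartiteAbove (fun P Q : Finset V => Q ⊆ P) D P =
        ({Q : Finset V | (#Q + 1 = Fintype.card I ∧ Q.image c = univ.erase i₀) ∧ Q ⊆ P} :
          Finset (Finset V)) := by
      ext Q
      simp only [bipartiteAbove, D, mem_filter, mem_univ, true_and]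
      exact ⟨fun h => ⟨h.1.1, h.2⟩, fun h => ⟨⟨h.1, hP.2.subset h.2⟩, h.2⟩⟩
    rw [this]
    refine even_card_facets c i₀ hP.1 fun h => ?_
    obtain ⟨i, hi⟩ := hcon P hP.1 hP.2
    obtain ⟨p, hp, hpi⟩ := h i
    exact hi p hp hpi
  let Q₀ := (univ.erase i₀).image e
  have hbelow : ∀ Q, bipartiteBelow (fun P Q : Finset V => Q ⊆ P) R Q =
      ({P : Finset V | (#P = Fintype.card I ∧ Dominant f P) ∧ Q ⊆ P} : Finset (Finset V)) := by
    intro Q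
    ext P
    simp [bipartiteBelow, R]
  have hboundary := card_rooms_boundary hf he hmin hmax hne i₀
  have hQ₀ : Q₀ ∈ D := by
    simp only [D, mem_filter, mem_univ, true_and]
    refine ⟨⟨?_, ?_⟩, ?_⟩
    · rw [card_image_of_injective _ he, card_erase_add_one (mem_univ _), card_univ]
    · simp [Q₀, image_image, Function.comp_def, hce]
    · obtain ⟨P, hP⟩ := card_eq_one.1 hboundary
      have : P ∈ ({P : Finset V | (#P = Fintype.card I ∧ Dominant f P) ∧
        (univ.erase i₀).image e ⊆ P} : Finset (Finset V)) := by rw [hP]; simp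
      simp only [mem_filter, mem_univ, true_and] at this
      exact this.1.2.subset this.2
  have hR : Odd (∑ Q ∈ D, #(bipartiteBelow (fun P Q : Finset V => Q ⊆ P) R Q)) := by
    rw [← Finset.add_sum_erase _ _ hQ₀]
    refine Odd.add_even ?_ (Finset.even_sum _ fun Q hQ => ?_)
    · rw [hbelow, hboundary]
      exact odd_one
    · simp only [D, mem_erase, mem_filter, mem_univ, true_and] at hQ
      obtain ⟨hQne, ⟨hQc, hQi⟩, hQd⟩ := hQ
      rw [hbelow, card_rooms_interior hf hmax hQc hQd]
      · exact even_two
      · by_contra! h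
        refine hQne (Finset.eq_of_subset_of_card_le (fun q hq => ?_) ?_)
        · obtain ⟨j, rfl⟩ := h q hq
          have : c (e j) ∈ Q.image c := mem_image_of_mem _ hq
          rw [hQi, hce] at this
          exact mem_image_of_mem _ this
        · refine card_image_le.trans ?_
          rw [← hQi]
          exact card_image_le
  rw [hcount] at hL
  exact (Nat.not_even_iff_odd.2 hR) hL

/-- For every coloring of the lattice points of a dilated simplex there is a cluster of nearby
points carrying all the colors of the coordinates that are not small on the cluster. -/
theorem exists_colorful_cluster {I : Type*} [Fintype I] [Nonempty I] (N : ℕ)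
    (c : (I → ℕ) → I) :
    ∃ S : Finset (I → ℕ), S.Nonempty ∧ (∀ t ∈ S, ∑ i, t i = N) ∧
      (∀ t ∈ S, ∀ t' ∈ S, ∀ i, t i ≤ t' i + Fintype.card I) ∧
      ∀ i, (∃ t ∈ S, c t = i) ∨ ∀ t ∈ S, t i ≤ Fintype.card I := by
  obtain ⟨i₀⟩ := id ‹Nonempty I›
  let T := {t : I → ℕ // t ∈ (piAntidiag univ N : Finset (I → ℕ))}
  have hT : ∀ t : T, ∑ i, t.1 i = N := fun t => (mem_piAntidiag.1 t.2).1
  have hTle : ∀ (t : T) i, t.1 i ≤ N := fun t i =>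
    (single_le_sum (fun _ _ => Nat.zero_le _) (mem_univ i)).trans (hT t).le
  let h : I → T ⊕ I → ℤ := fun i => Sum.elim (fun t => (t.1 i : ℤ))
    fun j => if j = i then -1 else N + 1
  let f : I → T ⊕ I → ℤ ×ₗ Fin (Fintype.card (T ⊕ I)) := fun i v =>
    toLex (h i v, Fintype.equivFin _ v)
  have hlt : ∀ i v w, h i v < h i w → f i v < f i w := fun i v w hh =>
    Prod.Lex.toLex_lt_toLex.2 (Or.inl hh)
  have hle : ∀ i v w, f i v ≤ f i w → h i v ≤ h i w := fun i v w hh => by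
    by_contra! hcon
    exact absurd (hlt i w v hcon) (not_lt.2 hh)
  have hrange : ∀ v : T ⊕ I, v ∉ Set.range (Sum.inr : I → T ⊕ I) → ∃ t, v = Sum.inl t := by
    rintro (t | j) hv
    · exact ⟨t, rfl⟩
    · exact absurd ⟨j, rfl⟩ hv
  have hpos : ∀ i t, 0 ≤ h i (Sum.inl t) := fun i t => by simp [h]
  have hneg : ∀ i, h i (Sum.inr i) = -1 := fun i => by simp [h]
  obtain ⟨P, hPc, hPd, hcol⟩ := exists_colorful_dominant (f := f)
    (fun i v w hvw => by
      have := congrArg (fun z => (ofLex z).2) hvw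
      exact (Fintype.equivFin _).injective this)
    (e := Sum.inr)
    (fun i v => by
      rcases v with t | j
      · exact (hlt _ _ _ (by rw [hneg]; have := hpos i t; omega)).le
      · by_cases hj : j = i
        · rw [hj]
        · exact (hlt _ _ _ (by rw [hneg]; simp only [h, Sum.elim_inr, if_neg hj]; omega)).le)
    (fun i j v hij hv => by
      obtain ⟨t, rfl⟩ := hrange v hv
      refine hlt _ _ _ ?_
      have := hTle t i
      simp only [h, Sum.elim_inl, Sum.elim_inr, if_neg hij.symm]
      omega)
    ⟨Sum.inl ⟨Pi.single i₀ N, by simp [mem_piAntidiag]⟩, by simp⟩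
    (Sum.elim (fun t => c t.1) id) (fun i => rfl)
  -- the lattice points of `P`
  let S : Finset (I → ℕ) := P.toLeft.image Subtype.val
  have hS : ∀ t : I → ℕ, t ∈ S ↔ ∃ ht : t ∈ piAntidiag univ N, Sum.inl ⟨t, ht⟩ ∈ P := by
    intro t; simp [S]
  have hSsum : ∀ t ∈ S, ∑ i, t i = N := fun t ht => by
    obtain ⟨ht, -⟩ := (hS t).1 ht
    exact hT ⟨t, ht⟩
  have hinj : Set.InjOn (Sum.elim (fun t : T => c t.1) id) P := by
    rw [← Finset.card_image_iff, hPc, ← card_univ]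
    congr 1
    rw [eq_univ_iff_forall]
    exact fun i => mem_image.2 (hcol i)
  have hSne : S.Nonempty := by
    by_contra hemp
    rw [not_nonempty_iff_eq_empty] at hemp
    have hall : ∀ i, Sum.inr i ∈ P := by
      intro i
      obtain ⟨p | j, hp, hpi⟩ := hcol i
      · have : p.1 ∈ S := (hS _).2 ⟨p.2, hp⟩
        simp [hemp] at this
      · simp only [Sum.elim_inr, id] at hpi
        exact hpi ▸ hp
    obtain ⟨l, hl⟩ := hPd (Sum.inl ⟨Pi.single i₀ N, by simp [mem_piAntidiag]⟩)
    have h1 := hle _ _ _ (hl _ (hall l))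
    rw [hneg] at h1
    have := hpos l ⟨Pi.single i₀ N, by simp [mem_piAntidiag]⟩
    omega
  let C : Finset I := {i | Sum.inr i ∉ P}
  have hmemC : ∀ i, i ∈ C ↔ Sum.inr i ∉ P := fun i => by simp [C]
  have hCcol : ∀ i ∈ C, ∃ t ∈ S, c t = i := by
    intro i hi
    obtain ⟨p | j, hp, hpi⟩ := hcol i
    · exact ⟨p.1, (hS _).2 ⟨p.2, hp⟩, hpi⟩
    · simp only [Sum.elim_inr, id] at hpi
      exact absurd (hpi ▸ hp) ((hmemC i).1 hi)
  choose μ hμS hμ using fun i => Finset.exists_min_image S (fun t => t i) hSne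
  let m : I → ℕ := fun i => μ i i
  obtain ⟨t₀, ht₀⟩ := hSne
  have hCne : c t₀ ∈ C := by
    rw [hmemC]
    intro hP
    obtain ⟨ht, hP'⟩ := (hS _).1 ht₀
    have := hinj hP hP' rfl
    simp at this
  have hkey : N < ∑ i ∈ C, (m i + 1) := by
    by_contra! hcon
    let y : I → ℕ := fun i => (if i ∈ C then m i + 1 else 0) +
      if i = c t₀ then N - ∑ i ∈ C, (m i + 1) else 0
    have hy : ∑ i, y i = N := by
      simp only [y, sum_add_distrib, sum_ite_mem, univ_inter, sum_ite_eq', mem_univ, if_true]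
      simp only [sum_add_distrib] at hcon ⊢
      omega
    have hyT : y ∈ (piAntidiag univ N : Finset (I → ℕ)) := mem_piAntidiag.2 ⟨hy, by simp⟩
    obtain ⟨l, hl⟩ := hPd (Sum.inl ⟨y, hyT⟩)
    by_cases hlC : l ∈ C
    · obtain ⟨hμT, hμP⟩ := (hS _).1 (hμS l)
      have h1 := hle _ _ _ (hl _ hμP)
      simp only [h, Sum.elim_inl, y, if_pos hlC] at h1
      have : m l = μ l l := rfl
      push_cast at h1
      omega
    · have h1 := hle _ _ _ (hl (Sum.inr l) (by rwa [hmemC, not_not] at hlC))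
      rw [hneg] at h1
      have := hpos l ⟨y, hyT⟩
      omega
  have hkey2 : N < ∑ i ∈ C, m i + Fintype.card I := by
    rw [sum_add_distrib, sum_const, smul_eq_mul, mul_one] at hkey
    have := card_le_univ C
    omega
  have hup : ∀ t ∈ S, ∀ i ∈ C, t i ≤ m i + Fintype.card I := by
    intro t ht i hi
    have h1 : ∑ j ∈ C, t j ≤ N := by
      rw [← hSsum t ht]
      exact sum_le_univ_sum_of_nonneg fun _ => Nat.zero_le _
    rw [← add_sum_erase _ _ hi] at h1 hkey2
    have h2 : ∑ j ∈ C.erase i, m j ≤ ∑ j ∈ C.erase i, t j := sum_le_sum fun j _ => hμ j t ht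
    omega
  have hsmall : ∀ t ∈ S, ∀ i, i ∉ C → t i ≤ Fintype.card I := by
    intro t ht i hi
    have h1 : ∑ j ∈ insert i C, t j ≤ N := by
      rw [← hSsum t ht]
      exact sum_le_univ_sum_of_nonneg fun _ => Nat.zero_le _
    rw [sum_insert hi] at h1
    have h2 : ∑ j ∈ C, m j ≤ ∑ j ∈ C, t j := sum_le_sum fun j _ => hμ j t ht
    omega
  refine ⟨S, ⟨t₀, ht₀⟩, hSsum, fun t ht t' ht' i => ?_, fun i => ?_⟩
  · by_cases hi : i ∈ C
    · have := hμ i t' ht'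
      have := hup t ht i hi
      have : m i = μ i i := rfl
      omega
    · have := hsmall t ht i hi
      omega
  · by_cases hi : i ∈ C
    · exact Or.inl (hCcol i hi)
    · exact Or.inr fun t ht => hsmall t ht i hi

/-- Approximate form of Brouwer's theorem on the standard simplex. -/
theorem exists_approx_fixedPoint_stdSimplex {I : Type*} [Fintype I] [Nonempty I]
    {F : (I → ℝ) → I → ℝ} (hF : ContinuousOn F (stdSimplex ℝ I))
    (hmaps : Set.MapsTo F (stdSimplex ℝ I) (stdSimplex ℝ I)) {δ : ℝ} (hδ : 0 < δ) :
    ∃ x ∈ stdSimplex ℝ I, ∀ i, x i - F x i ≤ δ := by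
  have huc := (isCompact_stdSimplex ℝ I).uniformContinuousOn_of_continuous hF
  rw [Metric.uniformContinuousOn_iff] at huc
  obtain ⟨η, hη, hFη⟩ := huc (δ / 2) (by linarith)
  set d := Fintype.card I with hd
  have hdpos : 0 < d := Fintype.card_pos
  obtain ⟨N, hN⟩ := exists_nat_gt ((d : ℝ) / min η (δ / 2))
  have hmin : 0 < min η (δ / 2) := lt_min hη (by linarith)
  have hN0 : (0 : ℝ) < N := lt_of_le_of_lt (by positivity) hN
  have hdN : (d : ℝ) / N < min η (δ / 2) := by
    rw [div_lt_iff₀ hmin] at hN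
    rw [div_lt_iff₀ hN0]
    linarith
  let X : (I → ℕ) → I → ℝ := fun t i => t i / N
  have hX : ∀ t : I → ℕ, ∑ i, t i = N → X t ∈ stdSimplex ℝ I := by
    intro t ht
    refine ⟨fun i => by positivity, ?_⟩
    simp only [X]
    rw [← sum_div, ← Nat.cast_sum, ht, div_self hN0.ne']
  have hcolor : ∀ t : I → ℕ, ∃ i, ∑ j, t j = N → X t i ≤ F (X t) i := by
    intro t
    by_cases ht : ∑ j, t j = N
    · obtain ⟨i, -, hi⟩ := Finset.exists_le_of_sum_le (s := univ) (f := X t) (g := F (X t))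
        univ_nonempty (by rw [(hX t ht).2, (hmaps (hX t ht)).2])
      exact ⟨i, fun _ => hi⟩
    · exact ⟨Classical.arbitrary I, fun h => absurd h ht⟩
  choose c hc using hcolor
  obtain ⟨S, ⟨t₀, ht₀⟩, hsum, hclose, hS⟩ := exists_colorful_cluster N c
  have hcl : ∀ t ∈ S, ∀ t' ∈ S, ∀ i, X t i - X t' i ≤ d / N := by
    intro t ht t' ht' i
    simp only [X]
    rw [← sub_div]
    refine div_le_div_of_nonneg_right ?_ hN0.le
    have : ((t i : ℕ) : ℝ) ≤ t' i + d := by exact_mod_cast hclose t ht t' ht' i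
    linarith
  have hx₀ := hX t₀ (hsum t₀ ht₀)
  refine ⟨X t₀, hx₀, fun i => ?_⟩
  rcases hS i with ⟨t, ht, hti⟩ | hi
  · have h1 := hc t (hsum t ht)
    rw [hti] at h1
    have h2 := hcl t₀ ht₀ t ht i
    have hdist : dist (X t) (X t₀) < η := by
      refine lt_of_le_of_lt ((dist_pi_le_iff (by positivity)).2 fun j => ?_)
        (hdN.trans_le (min_le_left _ _))
      rw [Real.dist_eq, abs_le]
      exact ⟨by linarith [hcl t₀ ht₀ t ht j], hcl t ht t₀ ht₀ j⟩
    have h3 := hFη _ (hX t (hsum t ht)) _ hx₀ hdist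
    have h4 := (dist_le_pi_dist (F (X t)) (F (X t₀)) i).trans_lt h3
    rw [Real.dist_eq, abs_lt] at h4
    linarith [hdN.trans_le (min_le_right _ _)]
  · have h1 : X t₀ i ≤ d / N := by
      refine div_le_div_of_nonneg_right ?_ hN0.le
      exact_mod_cast hi t₀ ht₀
    have h2 := (hmaps hx₀).1 i
    linarith [hdN.trans_le (min_le_right _ _)]

/-- **Brouwer's fixed point theorem** on the standard simplex. -/
theorem exists_fixedPoint_stdSimplex {I : Type*} [Fintype I] [Nonempty I]
    {F : (I → ℝ) → I → ℝ} (hF : ContinuousOn F (stdSimplex ℝ I))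
    (hmaps : Set.MapsTo F (stdSimplex ℝ I) (stdSimplex ℝ I)) :
    ∃ x ∈ stdSimplex ℝ I, F x = x := by
  have hcont : ContinuousOn (fun x => ∑ i, max (x i - F x i) 0) (stdSimplex ℝ I) := by
    refine continuousOn_finsetSum _ fun i _ => ContinuousOn.sup ?_ continuousOn_const
    exact (continuous_apply i).continuousOn.sub ((continuous_apply i).comp_continuousOn hF)
  obtain ⟨y, hy, -⟩ := exists_approx_fixedPoint_stdSimplex hF hmaps one_pos
  obtain ⟨x, hx, hxm⟩ := (isCompact_stdSimplex ℝ I).exists_isMinOn ⟨y, hy⟩ hcont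
  refine ⟨x, hx, ?_⟩
  have hd : (0 : ℝ) < Fintype.card I := by exact_mod_cast Fintype.card_pos
  have h0 : ∑ i, max (x i - F x i) 0 ≤ 0 := by
    refine le_of_forall_pos_le_add fun δ hδ => ?_
    obtain ⟨z, hz, hzδ⟩ := exists_approx_fixedPoint_stdSimplex hF hmaps (div_pos hδ hd)
    calc ∑ i, max (x i - F x i) 0 ≤ ∑ i, max (z i - F z i) 0 := hxm hz
      _ ≤ ∑ _i : I, δ / Fintype.card I := sum_le_sum fun i _ => max_le (hzδ i) (by positivity)
      _ = 0 + δ := by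
        rw [sum_const, card_univ, nsmul_eq_mul, zero_add, mul_div_cancel₀ _ hd.ne']
  have hle : ∀ i, x i ≤ F x i := by
    intro i
    have h1 := single_le_sum (f := fun i => max (x i - F x i) 0)
      (fun i _ => le_max_right _ _) (mem_univ i)
    have h2 := le_max_left (x i - F x i) 0
    linarith
  have hsum : ∑ i, x i = ∑ i, F x i := by rw [hx.2, (hmaps hx).2]
  ext i
  exact ((sum_eq_sum_iff_of_le fun i _ => hle i).1 hsum i (mem_univ i)).symm

theorem sum_prodProb {n m : ℕ} (x : Fin n → Fin m → ℝ) :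
    ∑ a, prodProb x a = ∏ i, ∑ b, x i b := by
  simp only [prodProb, Finset.prod_univ_sum, Fintype.piFinset_univ]

theorem prodProb_nonneg {n m : ℕ} {x : Fin n → Fin m → ℝ} (hx : ∀ i, IsDist (x i))
    (a : Fin n → Fin m) : 0 ≤ prodProb x a :=
  prod_nonneg fun i _ => (hx i).1 (a i)

theorem sum_prodProb_eq_one {n m : ℕ} {x : Fin n → Fin m → ℝ} (hx : ∀ i, IsDist (x i)) :
    ∑ a, prodProb x a = 1 := by
  rw [sum_prodProb]
  exact prod_eq_one fun i _ => (hx i).2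

theorem prodProb_update {n m : ℕ} (x : Fin n → Fin m → ℝ) (i : Fin n) (p : Fin m → ℝ)
    (a : Fin n → Fin m) :
    prodProb (Function.update x i p) a = p (a i) * ∏ j ∈ univ.erase i, x j (a j) := by
  rw [prodProb, ← mul_prod_erase _ _ (mem_univ i), Function.update_self]
  congr 1
  refine prod_congr rfl fun j hj => ?_
  rw [Function.update_of_ne (mem_erase.1 hj).1]

theorem EU_eq_sum_update {n m : ℕ} (u : (Fin n → Fin m) → ℝ) (x : Fin n → Fin m → ℝ)
    (i : Fin n) :
    EU u x = ∑ b, x i b * EU u (Function.update x i (pureStrat b)) := by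
  simp only [EU, mul_sum]
  rw [sum_comm]
  refine sum_congr rfl fun a _ => ?_
  simp only [prodProb_update, pureStrat, ite_mul, one_mul, zero_mul, mul_ite, mul_zero,
    sum_ite_eq, mem_univ, if_true]
  rw [prodProb, ← mul_prod_erase _ _ (mem_univ i), mul_assoc]

theorem EU_update_pureStrat {n m : ℕ} (u : (Fin n → Fin m) → ℝ) {x : Fin n → Fin m → ℝ}
    (i : Fin n) (hx : ∑ b, x i b = 1) (b : Fin m) :
    EU u (Function.update x i (pureStrat b)) = EU (fun a => u (Function.update a i b)) x := by
  have key : ∀ c, EU (fun a => u (Function.update a i b)) (Function.update x i (pureStrat c)) =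
      EU u (Function.update x i (pureStrat b)) := by
    intro c
    simp only [EU, prodProb_update, pureStrat, ite_mul, one_mul, zero_mul]
    rw [← sum_filter, ← sum_filter]
    refine sum_bij' (fun a _ => Function.update a i b) (fun a _ => Function.update a i c)
      (by simp) (by simp) ?_ ?_ ?_
    · intro a ha
      have : a i = c := by simpa using ha
      simp [← this]
    · intro a ha
      have : a i = b := by simpa using ha
      simp [← this]
    · intro a _
      congr 1
      refine prod_congr rfl fun j hj => ?_
      rw [Function.update_of_ne (mem_erase.1 hj).1]
  rw [EU_eq_sum_update _ x i]
  simp only [key]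
  rw [← sum_mul, hx, one_mul]

theorem continuous_EU {n m : ℕ} (u : (Fin n → Fin m) → ℝ) : Continuous (EU u) := by
  unfold EU prodProb
  fun_prop

/-- **Nash's theorem** for finite games. -/
theorem exists_isNash_zero {n m : ℕ} (hn : 0 < n) (hm : 0 < m)
    (u : Fin n → (Fin n → Fin m) → ℝ) :
    ∃ x : Fin n → Fin m → ℝ, (∀ i, IsDist (x i)) ∧ IsNash u x 0 := by
  have : Nonempty (Fin n) := ⟨⟨0, hn⟩⟩
  have : Nonempty (Fin m) := ⟨⟨0, hm⟩⟩
  have hn' : (0 : ℝ) < n := by exact_mod_cast hn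
  have hm' : (0 : ℝ) < m := by exact_mod_cast hm
  have hn1 : (0 : ℝ) < 1 / n := by positivity
  -- total mass of a player, and the retraction onto the product of simplices
  let w : (Fin n × Fin m → ℝ) → Fin n → ℝ := fun z i => ∑ b, z (i, b)
  let r : (Fin n × Fin m → ℝ) → Fin n → Fin m → ℝ := fun z i b =>
    (z (i, b) + max (1 / n - w z i) 0 / m) / max (w z i) (1 / n)
  let g : (Fin n → Fin m → ℝ) → Fin n → Fin m → ℝ := fun x i b =>
    max (EU (u i) (Function.update x i (pureStrat b)) - EU (u i) x) 0
  let F : (Fin n × Fin m → ℝ) → Fin n × Fin m → ℝ := fun z p =>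
    (r z p.1 p.2 + g (r z) p.1 p.2) / (n * (1 + ∑ b, g (r z) p.1 b))
  have hg0 : ∀ x i b, 0 ≤ g x i b := fun x i b => le_max_right _ _
  have hG0 : ∀ x i, 0 ≤ ∑ b, g x i b := fun x i => sum_nonneg fun b _ => hg0 x i b
  have hW : ∀ z i, 0 < max (w z i) (1 / n) := fun z i => lt_max_of_lt_right hn1
  have hr : ∀ z ∈ stdSimplex ℝ (Fin n × Fin m), ∀ i, IsDist (r z i) := by
    intro z hz i
    refine ⟨fun b => ?_, ?_⟩
    · have := hz.1 (i, b)
      exact div_nonneg (add_nonneg this (by positivity)) (hW z i).le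
    · simp only [r]
      rw [← sum_div, sum_add_distrib, sum_const, card_univ, Fintype.card_fin, nsmul_eq_mul,
        mul_div_cancel₀ _ hm'.ne', div_eq_one_iff_eq (hW z i).ne']
      change w z i + _ = _
      rcases le_total (w z i) (1 / n) with h | h
      · rw [max_eq_left (by linarith), max_eq_right h]; ring
      · rw [max_eq_right (by linarith), max_eq_left h]; ring
  have hFsum : ∀ z ∈ stdSimplex ℝ (Fin n × Fin m), ∀ i, ∑ b, F z (i, b) = 1 / n := by
    intro z hz i
    have h1 := hG0 (r z) i
    simp only [F]
    rw [← sum_div, sum_add_distrib, (hr z hz i).2]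
    have : (1 + ∑ b, g (r z) i b) ≠ 0 := by positivity
    field_simp
  have hFmaps : Set.MapsTo F (stdSimplex ℝ (Fin n × Fin m)) (stdSimplex ℝ (Fin n × Fin m)) := by
    intro z hz
    refine ⟨fun p => ?_, ?_⟩
    · exact div_nonneg (add_nonneg ((hr z hz p.1).1 p.2) (hg0 _ _ _))
        (mul_nonneg hn'.le (by linarith [hG0 (r z) p.1]))
    · rw [Fintype.sum_prod_type]
      simp only [hFsum z hz]
      rw [sum_const, card_univ, Fintype.card_fin, nsmul_eq_mul, mul_one_div_cancel hn'.ne']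
  have hwc : Continuous w := by fun_prop
  have hrc : Continuous r := by
    refine continuous_pi fun i => continuous_pi fun b => Continuous.div ?_ ?_ fun z => (hW z i).ne'
    · fun_prop
    · fun_prop
  have hgc : Continuous g := by
    refine continuous_pi fun i => continuous_pi fun b => Continuous.max ?_ continuous_const
    refine Continuous.sub ((continuous_EU _).comp ?_) (continuous_EU _)
    exact continuous_id.update i continuous_const
  have hgr : ∀ i b, Continuous fun z => g (r z) i b := fun i b =>
    (continuous_apply_apply i b).comp (hgc.comp hrc)
  have hFc : Continuous F := by
    refine continuous_pi fun p => Continuous.div ?_ ?_ fun z => ?_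
    · exact ((continuous_apply_apply p.1 p.2).comp hrc).add (hgr _ _)
    · exact continuous_const.mul (continuous_const.add (continuous_finsetSum _ fun b _ => hgr _ _))
    · have := hG0 (r z) p.1
      positivity
  obtain ⟨z, hz, hFz⟩ := exists_fixedPoint_stdSimplex hFc.continuousOn hFmaps
  have hwz : ∀ i, w z i = 1 / n := fun i => by
    rw [← hFsum z hz i, hFz]
  have hrz : ∀ i b, r z i b = n * z (i, b) := by
    intro i b
    simp only [r, hwz]
    simp
    ring
  refine ⟨r z, hr z hz, fun i b => ?_⟩
  set x := r z with hx
  have hfix : ∀ b, x i b * ∑ c, g x i c = g x i b := by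
    intro b
    have h1 : (x i b + g x i b) / (n * (1 + ∑ c, g x i c)) = z (i, b) := congrFun hFz (i, b)
    have h2 := hG0 x i
    have h3 : x i b = n * z (i, b) := hrz i b
    rw [div_eq_iff (by positivity)] at h1
    have : x i b + g x i b = x i b * (1 + ∑ c, g x i c) := by rw [h1, h3]; ring
    linarith
  obtain ⟨b₀, hb₀, hle⟩ : ∃ b, 0 < x i b ∧
      EU (u i) (Function.update x i (pureStrat b)) ≤ EU (u i) x := by
    by_contra! hcon
    have hdist := hr z hz i
    have hpos : ∃ b, 0 < x i b := by
      by_contra! h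
      have : ∑ b, x i b ≤ 0 := sum_nonpos fun b _ => h b
      linarith [hdist.2]
    obtain ⟨b₀, hb₀⟩ := hpos
    have : ∑ b, x i b * EU (u i) x < ∑ b, x i b * EU (u i) (Function.update x i (pureStrat b)) := by
      refine sum_lt_sum (fun b _ => ?_) ⟨b₀, mem_univ _, mul_lt_mul_of_pos_left (hcon b₀ hb₀) hb₀⟩
      rcases (hdist.1 b).eq_or_lt with h | h
      · change 0 = x i b at h
        rw [← h, zero_mul, zero_mul]
      · exact mul_le_mul_of_nonneg_left (hcon b h).le h.le
    rw [← EU_eq_sum_update, ← sum_mul, hdist.2, one_mul] at this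
    exact lt_irrefl _ this
  have hG : ∑ c, g x i c = 0 := by
    have h1 := hfix b₀
    have h2 : g x i b₀ = 0 := max_eq_right (by linarith)
    rw [h2] at h1
    exact (mul_eq_zero.1 h1).resolve_left hb₀.ne'
  have hgb : g x i b = 0 := by rw [← hfix b, hG, mul_zero]
  have := le_max_left (EU (u i) (Function.update x i (pureStrat b)) - EU (u i) x) 0
  change _ ≤ g x i b at this
  linarith

/-- Weak form of Hoeffding's lemma for finitely supported distributions. -/
theorem sum_mul_exp_le {ι : Type*} [Fintype ι] {p y : ι → ℝ} (hp : IsDist p)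
    (hy : ∀ a, |y a| ≤ 1) (h0 : ∑ a, p a * y a = 0) (l : ℝ) :
    ∑ a, p a * Real.exp (l * y a) ≤ Real.exp (l ^ 2 / 2) := by
  have hexp : ∀ a, Real.exp (l * y a) ≤ Real.cosh l + y a * Real.sinh l := by
    intro a
    obtain ⟨h1, h2⟩ := abs_le.1 (hy a)
    have := convexOn_exp.2 (Set.mem_univ l) (Set.mem_univ (-l))
      (show 0 ≤ (1 + y a) / 2 by linarith) (show 0 ≤ (1 - y a) / 2 by linarith) (by ring)
    simp only [smul_eq_mul] at this
    rw [show (1 + y a) / 2 * l + (1 - y a) / 2 * -l = l * y a by ring] at this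
    rw [Real.cosh_eq, Real.sinh_eq]
    linarith
  calc ∑ a, p a * Real.exp (l * y a)
      ≤ ∑ a, p a * (Real.cosh l + y a * Real.sinh l) :=
        sum_le_sum fun a _ => mul_le_mul_of_nonneg_left (hexp a) (hp.1 a)
    _ = (∑ a, p a) * Real.cosh l + (∑ a, p a * y a) * Real.sinh l := by
        rw [sum_mul, sum_mul, ← sum_add_distrib]
        exact sum_congr rfl fun a _ => by ring
    _ ≤ Real.exp (l ^ 2 / 2) := by
        rw [hp.2, h0, one_mul, zero_mul, add_zero]
        exact Real.cosh_le_exp_half_sq l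

theorem isDist_emp {n m k : ℕ} (hk : 0 < k) (a : Fin k → Fin n → Fin m) (i : Fin n) :
    IsDist (emp k a i) := by
  have hk' : (0 : ℝ) < k := by exact_mod_cast hk
  refine ⟨fun b => by unfold emp; positivity, ?_⟩
  unfold emp
  rw [← sum_div, ← Nat.cast_sum, ← card_eq_sum_card_fiberwise fun _ _ => mem_univ _,
    card_univ, Fintype.card_fin, div_self hk'.ne']

/-- The expected payoff under the empirical distributions is the average payoff over all ways of
choosing one sample for each player. -/
theorem EU_emp {n m k : ℕ} (v : (Fin n → Fin m) → ℝ) (a : Fin k → Fin n → Fin m) :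
    EU v (emp k a) = ∑ τ : Fin n → Fin k, ((k : ℝ) ^ n)⁻¹ * v fun i => a (τ i) i := by
  have h : ∀ p : Fin n → Fin m, prodProb (emp k a) p =
      ∑ τ : Fin n → Fin k, if p = (fun i => a (τ i) i) then ((k : ℝ) ^ n)⁻¹ else 0 := by
    intro p
    have h1 : ∀ i, emp k a i (p i) = ∑ t, if a t i = p i then (k : ℝ)⁻¹ else 0 := by
      intro i
      rw [← sum_filter, sum_const, nsmul_eq_mul, emp, div_eq_mul_inv]
    simp only [prodProb, h1]
    rw [Finset.prod_univ_sum, Fintype.piFinset_univ]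
    refine sum_congr rfl fun τ _ => ?_
    by_cases hp : p = fun i => a (τ i) i
    · rw [if_pos hp, prod_congr rfl fun i _ => if_pos (congrFun hp i).symm, prod_const,
        card_univ, Fintype.card_fin, inv_pow]
    · rw [if_neg hp]
      obtain ⟨i, hi⟩ := Function.ne_iff.1 hp
      exact prod_eq_zero (mem_univ i) (if_neg (Ne.symm hi))
  simp only [EU, h, sum_mul, ite_mul, zero_mul]
  rw [sum_comm]
  simp

/-- Cyclically shifting the samples of each player by a fixed amount. -/
def shiftSamples {n m k : ℕ} [NeZero k] (τ : Fin n → Fin k) :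
    (Fin k → Fin n → Fin m) ≃ (Fin k → Fin n → Fin m) where
  toFun a s i := a (τ i + s) i
  invFun a s i := a (-τ i + s) i
  left_inv a := by ext s i; simp
  right_inv a := by ext s i; simp

theorem prod_prodProb_shiftSamples {n m k : ℕ} [NeZero k] (x : Fin n → Fin m → ℝ)
    (τ : Fin n → Fin k) (a : Fin k → Fin n → Fin m) :
    ∏ t, prodProb x (shiftSamples τ a t) = ∏ t, prodProb x (a t) := by
  simp only [prodProb]
  rw [prod_comm]
  conv_rhs => rw [prod_comm]
  refine prod_congr rfl fun i _ => ?_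
  exact Fintype.prod_equiv (Equiv.addLeft (τ i)) _ _ fun s => rfl

theorem EU_emp_eq_sum_shiftSamples {n m k : ℕ} [NeZero k] (v : (Fin n → Fin m) → ℝ)
    (a : Fin k → Fin n → Fin m) :
    EU v (emp k a) = ∑ τ : Fin n → Fin k,
      ((k : ℝ) ^ n)⁻¹ * ((k : ℝ)⁻¹ * ∑ s, v (shiftSamples τ a s)) := by
  have hk' : (k : ℝ) ≠ 0 := by exact_mod_cast NeZero.ne k
  rw [EU_emp]
  simp only [← mul_sum]
  congr 1
  rw [sum_comm]
  have : ∀ s : Fin k, ∑ τ : Fin n → Fin k, v (shiftSamples τ a s) =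
      ∑ τ : Fin n → Fin k, v fun i => a (τ i) i := fun s =>
    Fintype.sum_equiv (Equiv.addRight fun _ => s) _ _ fun τ => rfl
  simp only [this]
  rw [sum_const, card_univ, Fintype.card_fin, nsmul_eq_mul, inv_mul_cancel_left₀ hk']

/-- The moment generating function of the average of a payoff over i.i.d. samples. -/
theorem sum_mul_exp_average_le {n m k : ℕ} (hk : 0 < k) {x : Fin n → Fin m → ℝ}
    (hx : ∀ i, IsDist (x i)) {v : (Fin n → Fin m) → ℝ} (hv : ∀ a, 0 ≤ v a ∧ v a ≤ 1) (l : ℝ) :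
    ∑ a : Fin k → Fin n → Fin m,
      (∏ t, prodProb x (a t)) * Real.exp (l * ((k : ℝ)⁻¹ * ∑ s, v (a s) - EU v x)) ≤
      Real.exp (l ^ 2 / (2 * k)) := by
  have hk' : (0 : ℝ) < k := by exact_mod_cast hk
  have hp : IsDist (prodProb x) := ⟨prodProb_nonneg hx, sum_prodProb_eq_one hx⟩
  have hEU0 : 0 ≤ EU v x := sum_nonneg fun a _ => mul_nonneg (hp.1 a) (hv a).1
  have hEU1 : EU v x ≤ 1 := by
    rw [← hp.2]
    exact sum_le_sum fun a _ => mul_le_of_le_one_right (hp.1 a) (hv a).2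
  have h1 := sum_mul_exp_le hp (y := fun a => v a - EU v x)
    (fun a => abs_le.2 ⟨by linarith [(hv a).1], by linarith [(hv a).2]⟩)
    (by
      simp only [mul_sub, sum_sub_distrib]
      rw [← sum_mul, hp.2, one_mul]
      exact sub_self _) (l / k)
  have h2 : ∀ a : Fin k → Fin n → Fin m,
      (∏ t, prodProb x (a t)) * Real.exp (l * ((k : ℝ)⁻¹ * ∑ s, v (a s) - EU v x)) =
      ∏ t, (prodProb x (a t) * Real.exp (l / k * (v (a t) - EU v x))) := by
    intro a
    rw [prod_mul_distrib, ← Real.exp_sum, ← mul_sum, sum_sub_distrib, sum_const, card_univ,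
      Fintype.card_fin, nsmul_eq_mul]
    congr 2
    field_simp
  simp only [h2]
  rw [← Fintype.piFinset_univ, ← Finset.prod_univ_sum (fun _ : Fin k => univ)
    (fun _ p => prodProb x p * Real.exp (l / k * (v p - EU v x))), prod_const, card_univ,
    Fintype.card_fin]
  calc _ ≤ Real.exp ((l / k) ^ 2 / 2) ^ k :=
        pow_le_pow_left₀ (sum_nonneg fun a _ => mul_nonneg (hp.1 a) (Real.exp_pos _).le) h1 k
    _ = Real.exp (l ^ 2 / (2 * k)) := by
        rw [← Real.exp_nat_mul]
        congr 1
        field_simp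

/-- The moment generating function of the expected payoff under the empirical distributions. -/
theorem sum_mul_exp_EU_emp_le {n m k : ℕ} (hk : 0 < k) {x : Fin n → Fin m → ℝ}
    (hx : ∀ i, IsDist (x i)) {v : (Fin n → Fin m) → ℝ} (hv : ∀ a, 0 ≤ v a ∧ v a ≤ 1) (l : ℝ) :
    ∑ a : Fin k → Fin n → Fin m,
      (∏ t, prodProb x (a t)) * Real.exp (l * (EU v (emp k a) - EU v x)) ≤
      Real.exp (l ^ 2 / (2 * k)) := by
  have hk' : (0 : ℝ) < k := by exact_mod_cast hk
  have : NeZero k := ⟨hk.ne'⟩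
  have hone : ∑ _τ : Fin n → Fin k, ((k : ℝ) ^ n)⁻¹ = 1 := by
    rw [sum_const, card_univ, Fintype.card_fun, Fintype.card_fin, Fintype.card_fin, nsmul_eq_mul,
      Nat.cast_pow, mul_inv_cancel₀ (pow_pos hk' n).ne']
  let E : (Fin k → Fin n → Fin m) → ℝ := fun a =>
    Real.exp (l * ((k : ℝ)⁻¹ * ∑ s, v (a s) - EU v x))
  have hjensen : ∀ a : Fin k → Fin n → Fin m, Real.exp (l * (EU v (emp k a) - EU v x)) ≤
      ∑ τ : Fin n → Fin k, ((k : ℝ) ^ n)⁻¹ * E (shiftSamples τ a) := by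
    intro a
    have := convexOn_exp.map_sum_le (t := univ) (w := fun _ : Fin n → Fin k => ((k : ℝ) ^ n)⁻¹)
      (p := fun τ => l * ((k : ℝ)⁻¹ * ∑ s, v (shiftSamples τ a s) - EU v x))
      (fun _ _ => by positivity) hone (fun _ _ => Set.mem_univ _)
    simp only [smul_eq_mul] at this
    refine le_trans (le_of_eq ?_) this
    congr 1
    rw [EU_emp_eq_sum_shiftSamples]
    simp only [mul_left_comm _ l, ← mul_sum]
    congr 1
    simp only [mul_sub, sum_sub_distrib, ← mul_sum]
    rw [sum_const, nsmul_eq_mul]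
    rw [sum_const, nsmul_eq_mul] at hone
    linear_combination EU v x * hone
  have hW : ∀ a : Fin k → Fin n → Fin m, 0 ≤ ∏ t, prodProb x (a t) := fun a =>
    prod_nonneg fun t _ => prodProb_nonneg hx _
  calc _ ≤ ∑ a : Fin k → Fin n → Fin m, (∏ t, prodProb x (a t)) *
          ∑ τ : Fin n → Fin k, ((k : ℝ) ^ n)⁻¹ * E (shiftSamples τ a) :=
        sum_le_sum fun a _ => mul_le_mul_of_nonneg_left (hjensen a) (hW a)
    _ = ∑ τ : Fin n → Fin k, ((k : ℝ) ^ n)⁻¹ *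
          ∑ a : Fin k → Fin n → Fin m, (∏ t, prodProb x (a t)) * E (shiftSamples τ a) := by
        simp only [mul_sum]
        rw [sum_comm]
        exact sum_congr rfl fun τ _ => sum_congr rfl fun a _ => by ring
    _ = ∑ _τ : Fin n → Fin k, ((k : ℝ) ^ n)⁻¹ *
          ∑ a : Fin k → Fin n → Fin m, (∏ t, prodProb x (a t)) * E a := by
        refine sum_congr rfl fun τ _ => ?_
        congr 1
        exact Fintype.sum_equiv (shiftSamples τ) _ _ fun a => by
          rw [prod_prodProb_shiftSamples]
    _ = ∑ a : Fin k → Fin n → Fin m, (∏ t, prodProb x (a t)) * E a := by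
        rw [← sum_mul, hone, one_mul]
    _ ≤ _ := sum_mul_exp_average_le hk hx hv l

/-- Every `n`-player `m`-action game admits a product distribution
in which every player's strategy is `k`-uniform and which is an `ε`-Nash equilibrium,
for every `ε ∈ (0,1)` and every integer `k > 8(ln m + ln n − ln ε + ln 8)/ε²`. -/
theorem stmt1 {n m : ℕ} (hn : 0 < n) (hm : 0 < m)
    (u : Fin n → (Fin n → Fin m) → ℝ)
    (hu : ∀ i a, 0 ≤ u i a ∧ u i a ≤ 1)
    (ε : ℝ) (hε : 0 < ε ∧ ε < 1)
    (k : ℕ)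
    (hk : (k : ℝ) > 8 * (Real.log m + Real.log n - Real.log ε + Real.log 8) / ε ^ 2) :
    ∃ s : Fin n → Fin m → ℝ,
      (∀ i, IsDist (s i)) ∧ (∀ i, IsKUniform k (s i)) ∧ IsNash u s ε := by
  obtain ⟨hε0, hε1⟩ := hε
  have hn1 : (1 : ℝ) ≤ n := by exact_mod_cast hn
  have hm1 : (1 : ℝ) ≤ m := by exact_mod_cast hm
  have hn0 : (0 : ℝ) < n := by linarith
  have hm0 : (0 : ℝ) < m := by linarith
  have hlog : Real.log m + Real.log n - Real.log ε + Real.log 8 = -Real.log (ε / (8 * n * m)) := by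
    rw [Real.log_div hε0.ne' (by positivity), Real.log_mul (by positivity) hm0.ne',
      Real.log_mul (by norm_num) hn0.ne']
    ring
  rw [hlog, gt_iff_lt, div_lt_iff₀ (by positivity)] at hk
  have hq : ε / (8 * n * m) < 1 := by
    rw [div_lt_one (by positivity)]
    nlinarith
  have hlogneg : Real.log (ε / (8 * n * m)) < 0 := Real.log_neg (by positivity) hq
  have hk0 : (0 : ℝ) < k := by
    by_contra! h
    have : (k : ℝ) * ε ^ 2 ≤ 0 := mul_nonpos_of_nonpos_of_nonneg h (by positivity)
    linarith
  have hkpos : 0 < k := by exact_mod_cast hk0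
  have htail : Real.exp (-(k * ε ^ 2 / 8)) < ε / (8 * n * m) := by
    rw [← Real.lt_log_iff_exp_lt (by positivity)]
    linarith
  obtain ⟨x, hx, hnash⟩ := exists_isNash_zero hn hm u
  let dev : Fin n → Fin m → (Fin n → Fin m) → ℝ := fun i b a => u i (Function.update a i b)
  let W : (Fin k → Fin n → Fin m) → ℝ := fun a => ∏ t, prodProb x (a t)
  -- exponential penalties of the bad events
  let A : Fin n → (Fin k → Fin n → Fin m) → ℝ := fun i a =>
    Real.exp (-(k * ε / 2) * (EU (u i) (emp k a) - EU (u i) x) - k * ε ^ 2 / 4)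
  let B : Fin n → Fin m → (Fin k → Fin n → Fin m) → ℝ := fun i b a =>
    Real.exp (k * ε / 2 * (EU (dev i b) (emp k a) - EU (dev i b) x) - k * ε ^ 2 / 4)
  have hpen : ∀ (v : (Fin n → Fin m) → ℝ), (∀ a, 0 ≤ v a ∧ v a ≤ 1) → ∀ l : ℝ,
      l ^ 2 = (k * ε / 2) ^ 2 →
      ∑ a, W a * Real.exp (l * (EU v (emp k a) - EU v x) - k * ε ^ 2 / 4) ≤
        ε / (8 * n * m) := by
    intro v hv l hl
    have h1 := sum_mul_exp_EU_emp_le hkpos hx hv l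
    have h2 : l ^ 2 / (2 * k) = k * ε ^ 2 / 8 := by rw [hl]; field_simp; ring
    rw [h2] at h1
    refine le_trans ?_ htail.le
    simp only [Real.exp_sub, mul_div_assoc', ← sum_div]
    rw [div_le_iff₀ (Real.exp_pos _), ← Real.exp_add,
      show -(k * ε ^ 2 / 8) + k * ε ^ 2 / 4 = k * ε ^ 2 / 8 by ring]
    exact h1
  obtain ⟨a, ha⟩ : ∃ a, (∀ i, A i a < 1) ∧ ∀ i b, B i b a < 1 := by
    by_contra! hcon
    have hWsum : ∑ a, W a = 1 := by
      have := Finset.prod_univ_sum (fun _ : Fin k => (univ : Finset (Fin n → Fin m)))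
        (fun _ p => prodProb x p)
      rw [Fintype.piFinset_univ, sum_prodProb_eq_one hx, prod_const_one] at this
      exact this.symm
    have hWnn : ∀ a, 0 ≤ W a := fun a => prod_nonneg fun t _ => prodProb_nonneg hx _
    have hA0 : ∀ i a, 0 ≤ A i a := fun i a => (Real.exp_pos _).le
    have hB0 : ∀ i b a, 0 ≤ B i b a := fun i b a => (Real.exp_pos _).le
    have hone : ∀ a, 1 ≤ ∑ i, A i a + ∑ i, ∑ b, B i b a := by
      intro a
      have hsA : 0 ≤ ∑ i, A i a := sum_nonneg fun i _ => hA0 i a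
      have hsB : ∀ i, 0 ≤ ∑ b, B i b a := fun i => sum_nonneg fun b _ => hB0 i b a
      by_cases h : ∀ i, A i a < 1
      · obtain ⟨i, b, hib⟩ := hcon a h
        have h1 := single_le_sum (f := fun b => B i b a) (fun b _ => hB0 i b a) (mem_univ b)
        have h2 := single_le_sum (f := fun i => ∑ b, B i b a) (fun i _ => hsB i) (mem_univ i)
        linarith
      · push Not at h
        obtain ⟨i, hi⟩ := h
        have h1 := single_le_sum (f := fun i => A i a) (fun i _ => hA0 i a) (mem_univ i)
        have h2 : 0 ≤ ∑ i, ∑ b, B i b a := sum_nonneg fun i _ => hsB i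
        linarith
    have h1 : (1 : ℝ) ≤ ∑ i, ∑ a, W a * A i a + ∑ i, ∑ b, ∑ a, W a * B i b a := by
      calc (1 : ℝ) = ∑ a, W a * 1 := by simp [hWsum]
        _ ≤ ∑ a, W a * (∑ i, A i a + ∑ i, ∑ b, B i b a) :=
          sum_le_sum fun a _ => mul_le_mul_of_nonneg_left (hone a) (hWnn a)
        _ = _ := by
          simp only [mul_add, sum_add_distrib, mul_sum]
          congr 1
          · exact sum_comm
          · rw [sum_comm]
            exact sum_congr rfl fun i _ => sum_comm
    have h2 : ∑ i, ∑ a, W a * A i a ≤ n * (ε / (8 * n * m)) := by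
      refine (sum_le_card_nsmul _ _ (ε / (8 * n * m)) fun i _ => ?_).trans (by simp)
      exact hpen (u i) (hu i) _ (by ring)
    have h3 : ∑ i, ∑ b, ∑ a, W a * B i b a ≤ n * (m * (ε / (8 * n * m))) := by
      refine (sum_le_card_nsmul _ _ (m * (ε / (8 * n * m))) fun i _ => ?_).trans (by simp)
      refine (sum_le_card_nsmul _ _ (ε / (8 * n * m)) fun b _ => ?_).trans (by simp)
      exact hpen (dev i b) (fun a => hu i _) _ rfl
    have h4 : (n : ℝ) * (m * (ε / (8 * n * m))) = ε / 8 := by field_simp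
    have h5 : (n : ℝ) * (ε / (8 * n * m)) ≤ n * (m * (ε / (8 * n * m))) :=
      mul_le_mul_of_nonneg_left (le_mul_of_one_le_left (by positivity) hm1) hn0.le
    linarith
  refine ⟨emp k a, isDist_emp hkpos a, fun i b => ⟨_, rfl⟩, fun i b => ?_⟩
  have hkε : 0 < k * ε / 2 := by positivity
  have h1 := Real.exp_lt_one_iff.1 (ha.1 i)
  have h2 := Real.exp_lt_one_iff.1 (ha.2 i b)
  have h1' : -(EU (u i) (emp k a) - EU (u i) x) < ε / 2 := by
    by_contra! h
    nlinarith [mul_le_mul_of_nonneg_left h hkε.le]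
  have h2' : EU (dev i b) (emp k a) - EU (dev i b) x < ε / 2 := by
    by_contra! h
    nlinarith [mul_le_mul_of_nonneg_left h hkε.le]
  have h3 := hnash i b
  rw [EU_update_pureStrat _ i (hx i).2] at h3
  rw [EU_update_pureStrat _ i (isDist_emp hkpos a i).2]
  change _ ≥ EU (dev i b) _ - _
  change _ ≥ EU (dev i b) _ - _ at h3
  linarith
end
end

section
/- For every ε ∈ (0,1) there exists a constant C = C(ε) > 0 such that every n-player m-action game admits a k-uniform distribution on A = [m]^n that is an ε-correlated equilibrium, for every integer k ≥ C·ln m·(ln m + ln n); in particular, every such game has an ε-correlated equilibrium whose support has size O(log m (log m + log n)). -/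
open Finset

open scoped Classical

noncomputable section

/-- Empirical distribution of `k` sampled elements of `A`. -/
def empJoint {A : Type*} [Fintype A] [DecidableEq A] (k : ℕ) (a : Fin k → A) : A → ℝ :=
  fun p => ((univ.filter fun t => a t = p).card : ℝ) / k

/-- Probability of the event `E` over `k` i.i.d. samples from the distribution `x`. -/
def PrJoint {A : Type*} [Fintype A] (k : ℕ) (x : A → ℝ) (E : (Fin k → A) → Prop) : ℝ :=
  ∑ a : Fin k → A, if E a then ∏ t, x (a t) else 0

/-- `x ∈ Δ(A)` is an `ε`-coarse correlated equilibrium of the game `u`: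
for every player `i` and action `j`, the expected regret for not playing `j`
is at most `ε`. -/
def IsCCE {n m : ℕ} (u : Fin n → (Fin n → Fin m) → ℝ)
    (x : (Fin n → Fin m) → ℝ) (ε : ℝ) : Prop :=
  ∀ (i : Fin n) (j : Fin m),
    ∑ a : Fin n → Fin m, x a * (u i (Function.update a i j) - u i a) ≤ ε

/-- `x ∈ Δ(A)` is an `ε`-correlated equilibrium of the game `u`:
for every player `i` and deviation map `f : [m] → [m]`, the expected regret is
at most `ε`. -/
def IsCE {n m : ℕ} (u : Fin n → (Fin n → Fin m) → ℝ)
    (x : (Fin n → Fin m) → ℝ) (ε : ℝ) : Prop :=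
  ∀ (i : Fin n) (f : Fin m → Fin m),
    ∑ a : Fin n → Fin m, x a * (u i (Function.update a i (f (a i))) - u i a) ≤ ε

theorem Polynomial.exists_eval_one_eq_sum (d : ℕ) {δ : ℝ} (hδ : 0 < δ) :
    ∃ t c : Fin (d + 1) → ℝ, (∀ i, 0 ≤ t i ∧ t i < δ) ∧
      ∀ p : Polynomial ℝ, p.natDegree ≤ d → p.eval 1 = ∑ i, c i * p.eval (t i) := by
  set t : Fin (d + 1) → ℝ := fun i => δ * (i / (d + 1)) with ht
  have hinj : Set.InjOn t (univ : Finset (Fin (d + 1))) := by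
    intro i _ j _ hij
    simp only [ht] at hij
    have h1 : (i : ℝ) / (d + 1) = j / (d + 1) := mul_left_cancel₀ hδ.ne' hij
    have h2 : (i : ℝ) = j := by field_simp at h1; exact h1
    exact Fin.ext (by exact_mod_cast h2)
  refine ⟨t, fun i => (Lagrange.basis univ t i).eval 1, fun i => ⟨by positivity, ?_⟩, fun p hp => ?_⟩
  · have : (i : ℝ) / (d + 1) < 1 := by
      rw [div_lt_one (by positivity)]
      exact_mod_cast i.2
    calc δ * (i / (d + 1)) < δ * 1 := by gcongr
      _ = δ := mul_one δ
  · have hdeg : p.degree < ((univ : Finset (Fin (d + 1))).card : WithBot ℕ) := by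
      rw [Finset.card_fin]
      exact lt_of_le_of_lt (Polynomial.degree_le_of_natDegree_le hp) (by exact_mod_cast Nat.lt_succ_self d)
    have h := congrArg (Polynomial.eval 1) (Lagrange.eq_interpolate hinj hdeg)
    rw [h, Lagrange.interpolate_apply, Polynomial.eval_finsetSum]
    exact Finset.sum_congr rfl fun i _ => by simp [mul_comm]

section Retraction

variable {E : Type*} [NormedAddCommGroup E] [InnerProductSpace ℝ E]

theorem ContinuousLinearMap.exists_polynomial_det_one_add_smul [FiniteDimensional ℝ E]
    (A : E →L[ℝ] E) :
    ∃ p : Polynomial ℝ, p.natDegree ≤ Module.finrank ℝ E ∧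
      ∀ t : ℝ, p.eval t = (1 + t • A).det := by
  set b := Module.finBasis ℝ E
  set M := LinearMap.toMatrix b b (A : E →ₗ[ℝ] E) with hM
  refine ⟨((Polynomial.X : Polynomial ℝ) • M.map (Polynomial.C : ℝ →+* Polynomial ℝ) +
    (1 : Matrix (Fin (Module.finrank ℝ E)) (Fin (Module.finrank ℝ E)) ℝ).map
      (Polynomial.C : ℝ →+* Polynomial ℝ)).det, ?_, fun t => ?_⟩
  · simpa using Polynomial.natDegree_det_X_add_C_le M 1
  · have h1 : (1 + t • A).det = (1 + t • M).det := by
      rw [ContinuousLinearMap.det, ← LinearMap.det_toMatrix b]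
      congr 1
      simp [hM, LinearMap.toMatrix_one]
    rw [h1, ← Polynomial.coe_evalRingHom, RingHom.map_det]
    congr 1
    ext i j
    simp [Matrix.one_apply, add_comm]
    split_ifs <;> simp [mul_comm]

theorem ContinuousLinearMap.det_ne_zero_of_ker [FiniteDimensional ℝ E] {A : E →L[ℝ] E}
    (h : ∀ x, A x = 0 → x = 0) :
    A.det ≠ 0 := by
  intro h0
  refine (LinearMap.det_eq_zero_iff_ker_ne_bot.1 h0) ?_
  rw [LinearMap.ker_eq_bot']
  exact h

theorem ContinuousLinearMap.det_one_add_pos [FiniteDimensional ℝ E] {A : E →L[ℝ] E}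
    (hA : ‖A‖ < 1) :
    0 < (1 + A).det := by
  obtain ⟨p, -, hp⟩ := A.exists_polynomial_det_one_add_smul
  have hne : ∀ t ∈ Set.Icc (0 : ℝ) 1, p.eval t ≠ 0 := by
    intro t ht
    rw [hp]
    refine ContinuousLinearMap.det_ne_zero_of_ker fun x hx => ?_
    by_contra hx0
    have h1 : x = -(t • A x) := by
      rw [eq_neg_iff_add_eq_zero]
      simpa using hx
    have h2 : ‖x‖ ≤ ‖A‖ * ‖x‖ := by
      calc ‖x‖ = |t| * ‖A x‖ := by
            conv_lhs => rw [h1]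
            rw [norm_neg, norm_smul, Real.norm_eq_abs]
        _ ≤ 1 * ‖A x‖ := by
            gcongr
            rw [abs_of_nonneg ht.1]; exact ht.2
        _ ≤ ‖A‖ * ‖x‖ := by rw [one_mul]; exact A.le_opNorm x
    have h3 : 0 < ‖x‖ := norm_pos_iff.2 hx0
    nlinarith
  have h0 : p.eval 0 = 1 := by
    rw [hp]
    simp [ContinuousLinearMap.det]
  have h1 : p.eval 1 = (1 + A).det := by rw [hp, one_smul]
  rw [← h1]
  by_contra! hneg
  obtain ⟨t, ht, ht0⟩ := intermediate_value_Icc' (zero_le_one' ℝ) p.continuous.continuousOn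
    (show (0 : ℝ) ∈ Set.Icc (p.eval 1) (p.eval 0) by rw [h0]; exact ⟨hneg, zero_le_one⟩)
  exact hne t ht ht0

theorem exists_lipschitz_extension_by_zero {g : E → E} {K : ℝ} (hK : 0 ≤ K)
    (hg : ∀ x ∈ Metric.closedBall (0 : E) 1, ∀ y ∈ Metric.closedBall (0 : E) 1,
      ‖g x - g y‖ ≤ K * ‖x - y‖)
    (hg0 : ∀ x, ‖x‖ = 1 → g x = 0) (x y : E) :
    ‖(if ‖x‖ ≤ 1 then g x else 0) - (if ‖y‖ ≤ 1 then g y else 0)‖ ≤ K * ‖x - y‖ := by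
  have key : ∀ x y : E, ‖x‖ ≤ 1 → 1 < ‖y‖ → ‖g x‖ ≤ K * ‖x - y‖ := by
    intro x y hx hy
    obtain ⟨z, hz, hz1⟩ := (convex_segment x y).isPreconnected.intermediate_value
      (left_mem_segment ℝ x y) (right_mem_segment ℝ x y)
      (continuous_norm (E := E)).continuousOn (show (1 : ℝ) ∈ Set.Icc ‖x‖ ‖y‖ from ⟨hx, hy.le⟩)
    have h1 := hg x (by simpa using hx) z (by simpa using hz1.le)
    have h2 := dist_add_dist_of_mem_segment hz
    rw [hg0 z hz1, sub_zero] at h1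
    rw [dist_eq_norm, dist_eq_norm, dist_eq_norm] at h2
    refine h1.trans (mul_le_mul_of_nonneg_left ?_ hK)
    linarith [norm_nonneg (z - y)]
  split_ifs with hx hy hy
  · exact hg x (by simpa using hx) y (by simpa using hy)
  · rw [sub_zero]; exact key x y hx (not_le.1 hy)
  · rw [zero_sub, norm_neg, norm_sub_rev]; exact key y x hy (not_le.1 hx)
  · simpa using mul_nonneg hK (norm_nonneg _)

theorem image_ball_of_lipschitz_perturbation [FiniteDimensional ℝ E] {g : E → E} {K : ℝ} (hK : 0 ≤ K)
    (hg : ∀ x ∈ Metric.closedBall (0 : E) 1, ∀ y ∈ Metric.closedBall (0 : E) 1,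
      ‖g x - g y‖ ≤ K * ‖x - y‖)
    (hg0 : ∀ x, ‖x‖ = 1 → g x = 0) {t : ℝ} (ht0 : 0 ≤ t) (ht : t * K < 1) :
    Set.InjOn (fun x => x + t • g x) (Metric.ball 0 1) ∧
      (fun x => x + t • g x) '' Metric.ball (0 : E) 1 = Metric.ball 0 1 := by
  set G : E → E := fun x => if ‖x‖ ≤ 1 then g x else 0 with hG
  have hlip := exists_lipschitz_extension_by_zero hK hg hg0
  have hGb : ∀ x, ‖x‖ < 1 → G x = g x := fun x hx => if_pos hx.le
  have hGo : ∀ x, 1 ≤ ‖x‖ → G x = 0 := by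
    intro x hx
    rcases hx.eq_or_lt with h | h
    · simp only [hG]; rw [if_pos h.ge, hg0 x h.symm]
    · exact if_neg (not_le.2 h)
  have happrox : ApproximatesLinearOn (fun x => x + t • G x)
      ((ContinuousLinearEquiv.refl ℝ E : E ≃L[ℝ] E) : E →L[ℝ] E) Set.univ
      ⟨t * K, mul_nonneg ht0 hK⟩ := by
    intro x _ y _
    have : x + t • G x - (y + t • G y) -
        ((ContinuousLinearEquiv.refl ℝ E : E ≃L[ℝ] E) : E →L[ℝ] E) (x - y) =
        t • (G x - G y) := by
      simp [smul_sub]; abel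
    rw [this, norm_smul, Real.norm_eq_abs, abs_of_nonneg ht0]
    change _ ≤ t * K * _
    rw [mul_assoc]
    exact mul_le_mul_of_nonneg_left (hlip x y) ht0
  have hc : Subsingleton E ∨ (⟨t * K, mul_nonneg ht0 hK⟩ : NNReal) <
      ‖(((ContinuousLinearEquiv.refl ℝ E : E ≃L[ℝ] E).symm : E ≃L[ℝ] E) : E →L[ℝ] E)‖₊⁻¹ := by
    rcases subsingleton_or_nontrivial E with h | h
    · exact Or.inl h
    · right
      have : ‖(((ContinuousLinearEquiv.refl ℝ E : E ≃L[ℝ] E).symm : E ≃L[ℝ] E) : E →L[ℝ] E)‖₊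
          = 1 := by
        ext
        exact ContinuousLinearMap.norm_id
      rw [this, inv_one]
      exact ht
  have hbij : Function.Bijective fun x => x + t • G x :=
    (happrox.toHomeomorph _ hc).bijective
  have heq : Set.EqOn (fun x => x + t • G x) (fun x => x + t • g x) (Metric.ball 0 1) := by
    intro x hx
    simp only
    rw [hGb x (by simpa using hx)]
  have hout : ∀ x, 1 ≤ ‖x‖ → x + t • G x = x := fun x hx => by rw [hGo x hx, smul_zero, add_zero]
  refine ⟨hbij.1.injOn.congr heq, ?_⟩
  rw [← heq.image_eq]
  ext y
  simp only [Set.mem_image, mem_ball_zero_iff]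
  constructor
  · rintro ⟨x, hx, rfl⟩
    by_contra! hy
    have := hbij.1 (show (fun x => x + t • G x) (x + t • G x) = (fun x => x + t • G x) x from
      hout _ hy)
    rw [this] at hy
    exact absurd hx (not_lt.2 hy)
  · intro hy
    obtain ⟨x, hx⟩ := hbij.2 y
    refine ⟨x, ?_, hx⟩
    by_contra! h
    rw [← hx] at hy
    simp only [hout x h] at hy
    exact absurd hy (not_lt.2 h)

theorem not_exists_smooth_retraction [FiniteDimensional ℝ E] {r : E → E}
    (hr : ∀ x, ‖x‖ ≤ 1 → ContDiffAt ℝ 1 r x) (hr1 : ∀ x, ‖x‖ ≤ 1 → ‖r x‖ = 1)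
    (hid : ∀ x, ‖x‖ = 1 → r x = x) : False := by
  borelize E
  let μ : MeasureTheory.Measure E := MeasureTheory.Measure.addHaar
  set g : E → E := fun x => r x - x with hgdef
  have hg : ∀ x, ‖x‖ ≤ 1 → ContDiffAt ℝ 1 g x := fun x hx => (hr x hx).sub contDiffAt_id
  have hcont : ContinuousOn (fderiv ℝ g) (Metric.closedBall 0 1) := fun x hx =>
    ((hg x (by simpa using hx)).continuousAt_fderiv one_ne_zero).continuousWithinAt
  obtain ⟨K₀, hK₀⟩ := (isCompact_closedBall (0 : E) 1).exists_bound_of_continuousOn hcont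
  set K := max K₀ 0 + 1 with hKdef
  have hK : 0 < K := by positivity
  have hKb : ∀ x ∈ Metric.closedBall (0 : E) 1, ‖fderiv ℝ g x‖ ≤ K := fun x hx =>
    (hK₀ x hx).trans (by rw [hKdef]; linarith [le_max_left K₀ 0])
  have hdiff : ∀ x ∈ Metric.closedBall (0 : E) 1, DifferentiableAt ℝ g x := fun x hx =>
    (hg x (by simpa using hx)).differentiableAt one_ne_zero
  have hlip : ∀ x ∈ Metric.closedBall (0 : E) 1, ∀ y ∈ Metric.closedBall (0 : E) 1,
      ‖g x - g y‖ ≤ K * ‖x - y‖ := fun x hx y hy =>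
    (convex_closedBall (0 : E) 1).norm_image_sub_le_of_norm_fderiv_le hdiff hKb hy hx
  have hg0 : ∀ x, ‖x‖ = 1 → g x = 0 := fun x hx => by simp [hgdef, hid x hx]
  obtain ⟨t, c, ht, hp⟩ := Polynomial.exists_eval_one_eq_sum (Module.finrank ℝ E)
    (δ := K⁻¹) (by positivity)
  have htK : ∀ i, t i * K < 1 := fun i => by
    have := mul_lt_mul_of_pos_right (ht i).2 hK
    rwa [inv_mul_cancel₀ hK.ne'] at this
  have hdet : ∀ A : E →L[ℝ] E, (1 + A).det = ∑ i, c i * (1 + t i • A).det := by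
    intro A
    obtain ⟨p, hpd, hpe⟩ := A.exists_polynomial_det_one_add_smul
    have := hp p hpd
    simp only [hpe, one_smul] at this
    exact this
  have hcsum : ∑ i, c i = 1 := by
    have := hp 1 (by simp)
    simpa using this.symm
  have hint : ∀ i, ∫ x in Metric.ball (0 : E) 1, (1 + t i • fderiv ℝ g x).det ∂μ =
      μ.real (Metric.ball 0 1) := by
    intro i
    obtain ⟨hinj, himg⟩ := image_ball_of_lipschitz_perturbation hK.le hlip hg0 (ht i).1 (htK i)
    have h := MeasureTheory.integral_image_eq_integral_abs_det_fderiv_smul μ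
      (s := Metric.ball (0 : E) 1) (f := fun x => x + t i • g x)
      (f' := fun x => 1 + t i • fderiv ℝ g x) Metric.isOpen_ball.measurableSet
      (fun x hx => ((hasFDerivAt_id x).add
        ((hdiff x (Metric.ball_subset_closedBall hx)).hasFDerivAt.const_smul
          (t i))).hasFDerivWithinAt) hinj (fun _ => (1 : ℝ))
    rw [himg] at h
    rw [MeasureTheory.setIntegral_const, smul_eq_mul, mul_one] at h
    rw [h]
    refine MeasureTheory.setIntegral_congr_fun Metric.isOpen_ball.measurableSet fun x hx => ?_
    have hpos : 0 < (1 + t i • fderiv ℝ g x).det := by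
      refine ContinuousLinearMap.det_one_add_pos ?_
      rw [norm_smul, Real.norm_eq_abs, abs_of_nonneg (ht i).1]
      exact (mul_le_mul_of_nonneg_left (hKb x (Metric.ball_subset_closedBall hx))
        (ht i).1).trans_lt (htK i)
    simp only [smul_eq_mul, mul_one]
    exact (abs_of_pos hpos).symm
  have hzero : ∀ x ∈ Metric.ball (0 : E) 1, (1 + fderiv ℝ g x).det = 0 := by
    intro x hx
    have hxn : ‖x‖ < 1 := by simpa using hx
    have hrd := (hr x hxn.le).differentiableAt one_ne_zero
    have hfd : 1 + fderiv ℝ g x = fderiv ℝ r x := by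
      have : HasFDerivAt g (fderiv ℝ r x - 1) x := hrd.hasFDerivAt.sub (hasFDerivAt_id x)
      rw [this.fderiv]; abel
    rw [hfd]
    by_contra hne
    have hsurj : Function.Surjective (fderiv ℝ r x) := by
      have hu : IsUnit (LinearMap.det (fderiv ℝ r x : E →ₗ[ℝ] E)) := isUnit_iff_ne_zero.2 hne
      exact ((Module.End.isUnit_iff _).1 ((LinearMap.isUnit_iff_isUnit_det _).2 hu)).2
    obtain ⟨v, hv⟩ := hsurj (r x)
    have h1 : HasFDerivAt (fun y => inner ℝ (r y) (r y)) _ x :=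
      hrd.hasFDerivAt.inner ℝ hrd.hasFDerivAt
    have h2 : (fun y => inner ℝ (r y) (r y)) =ᶠ[nhds x] fun _ => (1 : ℝ) := by
      filter_upwards [Metric.isOpen_ball.mem_nhds hx] with y hy
      rw [real_inner_self_eq_norm_sq, hr1 y (by simpa using (mem_ball_zero_iff.1 hy).le), one_pow]
    have h3 := h1.unique ((hasFDerivAt_const (1 : ℝ) x).congr_of_eventuallyEq h2)
    have h4 := congrArg (fun L : E →L[ℝ] ℝ => L v) h3
    simp [hv, hr1 x hxn.le] at h4
  have hI : ∀ i, MeasureTheory.IntegrableOn (fun x => c i * (1 + t i • fderiv ℝ g x).det)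
      (Metric.ball (0 : E) 1) μ := by
    intro i
    refine (ContinuousOn.integrableOn_compact (isCompact_closedBall (0 : E) 1) ?_).mono_set
      Metric.ball_subset_closedBall
    exact continuousOn_const.mul (ContinuousLinearMap.continuous_det.comp_continuousOn
      (continuousOn_const.add (hcont.const_smul (t i))))
  have hfinal : (0 : ℝ) = μ.real (Metric.ball 0 1) := by
    calc (0 : ℝ) = ∫ x in Metric.ball (0 : E) 1, (1 + fderiv ℝ g x).det ∂μ :=
          (MeasureTheory.setIntegral_eq_zero_of_forall_eq_zero hzero).symm
      _ = ∑ i, c i * μ.real (Metric.ball 0 1) := by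
          rw [show (fun x => (1 + fderiv ℝ g x).det) =
            fun x => ∑ i, c i * (1 + t i • fderiv ℝ g x).det from funext fun x => hdet _]
          rw [MeasureTheory.integral_finsetSum _ fun i _ => hI i]
          simp_rw [MeasureTheory.integral_const_mul, hint]
      _ = μ.real (Metric.ball 0 1) := by rw [← Finset.sum_mul, hcsum, one_mul]
  have hpos : 0 < μ.real (Metric.ball (0 : E) 1) :=
    ENNReal.toReal_pos (Metric.measure_ball_pos μ 0 one_pos).ne'
      MeasureTheory.measure_ball_lt_top.ne
  linarith

theorem exists_fixedPoint_of_norm_lt_one [FiniteDimensional ℝ E] {F : E → E}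
    (hF : ContDiff ℝ 1 F) (hb : ∀ x, ‖F x‖ < 1) : ∃ x, F x = x := by
  by_contra! hne
  set v : E → E := fun x => x - F x with hv
  set p : E → ℝ := fun x => inner ℝ x (v x) with hp
  set q : E → ℝ := fun x => inner ℝ (v x) (v x) with hq
  set D : E → ℝ := fun x => p x ^ 2 + q x * (1 - inner ℝ x x) with hD
  have hvs : ContDiff ℝ 1 v := contDiff_id.sub hF
  have hps : ContDiff ℝ 1 p := contDiff_id.inner ℝ hvs
  have hqs : ContDiff ℝ 1 q := hvs.inner ℝ hvs
  have hDs : ContDiff ℝ 1 D :=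
    (hps.pow 2).add (hqs.mul (contDiff_const.sub (contDiff_id.inner ℝ contDiff_id)))
  have hqpos : ∀ x, 0 < q x := fun x => by
    simp only [hq, real_inner_self_eq_norm_sq]
    have : v x ≠ 0 := sub_ne_zero.2 (hne x).symm
    positivity
  have hppos : ∀ x, ‖x‖ = 1 → 0 < p x := by
    intro x hx
    have h1 : p x = 1 - inner ℝ x (F x) := by
      simp only [hp, hv, inner_sub_right, real_inner_self_eq_norm_sq, hx, one_pow]
    have h2 := real_inner_le_norm x (F x)
    rw [hx, one_mul] at h2
    linarith [hb x]
  have hDpos : ∀ x, ‖x‖ ≤ 1 → 0 < D x := by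
    intro x hx
    simp only [hD, real_inner_self_eq_norm_sq]
    rcases hx.eq_or_lt with h | h
    · have := hppos x h
      rw [h]; norm_num; positivity
    · have h1 : 0 < 1 - ‖x‖ ^ 2 := by nlinarith [norm_nonneg x]
      have := mul_pos (hqpos x) h1
      positivity
  set l : E → ℝ := fun x => (√(D x) - p x) / q x with hl
  refine not_exists_smooth_retraction (r := fun x => x + l x • v x) (fun x hx => ?_)
    (fun x hx => ?_) (fun x hx => ?_)
  · refine contDiffAt_id.add (ContDiffAt.smul ?_ hvs.contDiffAt)
    exact ((hDs.contDiffAt.sqrt (hDpos x hx).ne').sub hps.contDiffAt).div hqs.contDiffAt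
      (hqpos x).ne'
  · have h1 : ‖x + l x • v x‖ ^ 2 = inner ℝ x x + 2 * l x * p x + l x ^ 2 * q x := by
      rw [← real_inner_self_eq_norm_sq]
      simp only [inner_add_left, inner_add_right, inner_smul_left, inner_smul_right, hp, hq,
        real_inner_comm x (v x)]
      simp
      ring
    have h2 : l x * q x = √(D x) - p x := div_mul_cancel₀ _ (hqpos x).ne'
    have h3 : √(D x) ^ 2 = p x ^ 2 + q x * (1 - inner ℝ x x) := Real.sq_sqrt (hDpos x hx).le
    have h4 : q x * (‖x + l x • v x‖ ^ 2 - 1) = 0 := by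
      rw [h1]
      linear_combination (l x * q x + √(D x) + p x) * h2 + h3
    have h5 : ‖x + l x • v x‖ ^ 2 = 1 := by
      have := (mul_eq_zero.1 h4).resolve_left (hqpos x).ne'
      linarith
    exact (pow_eq_one_iff_of_nonneg (norm_nonneg _) two_ne_zero).1 h5
  · have h1 : D x = p x ^ 2 := by
      simp only [hD, real_inner_self_eq_norm_sq, hx]; ring
    have h2 : l x = 0 := by
      simp only [hl]
      rw [h1, Real.sqrt_sq (hppos x hx).le, sub_self, zero_div]
    simp [h2]

/-- A bounded `C¹` self-map of a finite-dimensional inner product space has a fixed point. -/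
theorem exists_fixedPoint_of_bounded [FiniteDimensional ℝ E] {F : E → E} {R : ℝ}
    (hF : ContDiff ℝ 1 F) (hb : ∀ x, ‖F x‖ < R) : ∃ x, F x = x := by
  have hR : 0 < R := (norm_nonneg _).trans_lt (hb 0)
  obtain ⟨x, hx⟩ := exists_fixedPoint_of_norm_lt_one (F := fun x => R⁻¹ • F (R • x))
    ((hF.comp (contDiff_id.const_smul R)).const_smul R⁻¹) (fun x => by
      rw [norm_smul, Real.norm_eq_abs, abs_of_pos (inv_pos.2 hR), inv_mul_lt_iff₀ hR, mul_one]
      exact hb _)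
  refine ⟨R • x, ?_⟩
  conv_rhs => rw [← hx, smul_smul, mul_inv_cancel₀ hR.ne', one_smul]

end Retraction

section ProductDistributions

theorem sum_prod_eq_one {I M : Type*} [Fintype I] [DecidableEq I] [Fintype M] {x : I → M → ℝ}
    (hx : ∀ i, ∑ j, x i j = 1) : ∑ a : I → M, ∏ l, x l (a l) = 1 := by
  rw [← Fintype.piFinset_univ, ← Finset.prod_univ_sum]
  simp [hx]

/-- Resampling one coordinate of a product distribution leaves expectations unchanged. -/
theorem sum_prod_mul_eq_sum_update {I M : Type*} [Fintype I] [DecidableEq I] [Fintype M]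
    {x : I → M → ℝ} {i : I} (hx : ∑ j, x i j = 1) (φ : (I → M) → ℝ) :
    ∑ a : I → M, (∏ l, x l (a l)) * φ a =
      ∑ j, x i j * ∑ a : I → M, (∏ l, x l (a l)) * φ (Function.update a i j) := by
  have hprod : ∀ (a : I → M) j, x i j * ∏ l, x l (a l) =
      x i (a i) * ∏ l, x l (Function.update a i j l) := by
    intro a j
    rw [← Finset.mul_prod_erase univ _ (mem_univ i),
      ← Finset.mul_prod_erase univ (fun l => x l (Function.update a i j l)) (mem_univ i),
      Function.update_self]
    have : ∏ l ∈ univ.erase i, x l (Function.update a i j l) = ∏ l ∈ univ.erase i, x l (a l) :=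
      Finset.prod_congr rfl fun l hl => by rw [Function.update_of_ne (Finset.ne_of_mem_erase hl)]
    rw [this]; ring
  have hswap : ∑ p : M × (I → M), x i p.1 * ((∏ l, x l (p.2 l)) * φ p.2) =
      ∑ p : M × (I → M), x i p.1 * ((∏ l, x l (p.2 l)) * φ (Function.update p.2 i p.1)) := by
    have hinv : Function.Involutive
        fun p : M × (I → M) => (p.2 i, Function.update p.2 i p.1) := fun p => by simp
    refine Fintype.sum_equiv hinv.toPerm _ _ fun p => ?_
    simp only [Function.Involutive.coe_toPerm, Function.update_idem, Function.update_eq_self]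
    rw [← mul_assoc, ← mul_assoc, hprod]
  rw [Fintype.sum_prod_type, Fintype.sum_prod_type] at hswap
  simp_rw [← Finset.mul_sum] at hswap
  rw [← hswap, ← Finset.sum_mul, hx, one_mul]

theorem mul_exp_ratio_le {M : Type*} [Fintype M] {β : ℝ} (hβ : 0 < β) (v : M → ℝ) (j k : M) :
    Real.exp (β * v j) / (∑ l, Real.exp (β * v l)) * (v k - v j) ≤ β⁻¹ := by
  have hpos : 0 < ∑ l, Real.exp (β * v l) :=
    Finset.sum_pos (fun _ _ => Real.exp_pos _) ⟨j, mem_univ j⟩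
  rcases le_total (v k) (v j) with h | h
  · exact (mul_nonpos_of_nonneg_of_nonpos (by positivity) (by linarith)).trans
      (inv_pos.2 hβ).le
  · have h1 : Real.exp (β * v k) ≤ ∑ l, Real.exp (β * v l) :=
      Finset.single_le_sum (f := fun l => Real.exp (β * v l)) (fun _ _ => (Real.exp_pos _).le)
        (mem_univ k)
    have h2 : β * (v k - v j) ≤ Real.exp (β * (v k - v j)) := by
      linarith [Real.add_one_le_exp (β * (v k - v j))]
    have h3 : Real.exp (β * v j) * Real.exp (β * (v k - v j)) = Real.exp (β * v k) := by
      rw [← Real.exp_add]; ring_nf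
    rw [div_mul_eq_mul_div, div_le_iff₀ hpos, inv_mul_eq_div, le_div_iff₀ hβ]
    calc Real.exp (β * v j) * (v k - v j) * β = Real.exp (β * v j) * (β * (v k - v j)) := by ring
      _ ≤ Real.exp (β * v j) * Real.exp (β * (v k - v j)) := by gcongr
      _ ≤ _ := h3.trans_le h1

/-- Every finite game has an approximate Nash equilibrium (a logit equilibrium). -/
theorem exists_approx_nash {I M : Type*} [Fintype I] [DecidableEq I] [Fintype M] [Nonempty M]
    (u : I → (I → M) → ℝ) {δ : ℝ} (hδ : 0 < δ) :
    ∃ x : I → M → ℝ, (∀ i j, 0 ≤ x i j) ∧ (∀ i, ∑ j, x i j = 1) ∧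
      ∀ i j, ∑ a : I → M, (∏ l, x l (a l)) * u i (Function.update a i j) ≤
        ∑ a : I → M, (∏ l, x l (a l)) * u i a + δ := by
  have hcard : (0 : ℝ) < Fintype.card M := by exact_mod_cast Fintype.card_pos
  set β : ℝ := Fintype.card M / δ with hβdef
  have hβ : 0 < β := by positivity
  set V : EuclideanSpace ℝ (I × M) → I → M → ℝ := fun y i j =>
    ∑ a : I → M, (∏ l, y (l, a l)) * u i (Function.update a i j) with hV
  have hVs : ∀ i j, ContDiff ℝ 1 fun y => V y i j := by
    intro i j
    refine ContDiff.sum fun a _ => ContDiff.mul (contDiff_prod fun l _ => ?_) contDiff_const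
    exact contDiff_euclidean.1 contDiff_id _
  have hZ : ∀ y i, 0 < ∑ k, Real.exp (β * V y i k) := fun y i =>
    Finset.sum_pos (fun _ _ => Real.exp_pos _) Finset.univ_nonempty
  set F : EuclideanSpace ℝ (I × M) → EuclideanSpace ℝ (I × M) := fun y =>
    WithLp.toLp 2 fun p => Real.exp (β * V y p.1 p.2) / ∑ k, Real.exp (β * V y p.1 k) with hF
  have hFs : ContDiff ℝ 1 F := by
    refine contDiff_euclidean.2 fun p => ?_
    exact ((contDiff_const.mul (hVs _ _)).exp).div
      (ContDiff.sum fun k _ => (contDiff_const.mul (hVs _ _)).exp) fun y => (hZ y p.1).ne'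
  have hFb : ∀ y, ‖F y‖ < Fintype.card (I × M) + 1 := by
    intro y
    rw [EuclideanSpace.norm_eq, Real.sqrt_lt' (by positivity)]
    have h1 : ∑ p, ‖F y p‖ ^ 2 ≤ ∑ _p : I × M, (1 : ℝ) := by
      refine Finset.sum_le_sum fun p _ => pow_le_one₀ (norm_nonneg _) ?_
      have h2 : F y p = Real.exp (β * V y p.1 p.2) / ∑ k, Real.exp (β * V y p.1 k) := rfl
      rw [h2, Real.norm_eq_abs, abs_of_pos (div_pos (Real.exp_pos _) (hZ _ _)),
        div_le_one (hZ _ _)]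
      exact Finset.single_le_sum (f := fun l => Real.exp (β * V y p.1 l))
        (fun _ _ => (Real.exp_pos _).le) (mem_univ p.2)
    rw [Finset.sum_const, Finset.card_univ, nsmul_eq_mul, mul_one] at h1
    nlinarith [Nat.cast_nonneg (α := ℝ) (Fintype.card (I × M))]
  obtain ⟨y, hy⟩ := exists_fixedPoint_of_bounded hFs hFb
  have hyp : ∀ i j, y (i, j) = Real.exp (β * V y i j) / ∑ k, Real.exp (β * V y i k) := by
    intro i j
    conv_lhs => rw [← hy]
  have hsum : ∀ i, ∑ j, y (i, j) = 1 := by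
    intro i
    simp_rw [hyp]
    rw [← Finset.sum_div, div_self (hZ y i).ne']
  refine ⟨fun i j => y (i, j), fun i j => ?_, hsum, fun i j => ?_⟩
  · simp only [hyp]
    exact div_nonneg (Real.exp_pos _).le (hZ y i).le
  · rw [sum_prod_mul_eq_sum_update (x := fun i j => y (i, j)) (hsum i) (u i)]
    change V y i j ≤ ∑ k, y (i, k) * V y i k + δ
    have h1 : ∑ k, y (i, k) * (V y i j - V y i k) ≤ ∑ _k : M, β⁻¹ := by
      refine Finset.sum_le_sum fun k _ => ?_
      rw [hyp]
      exact mul_exp_ratio_le hβ (V y i) k j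
    simp_rw [mul_sub] at h1
    rw [Finset.sum_sub_distrib, ← Finset.sum_mul, hsum, one_mul, Finset.sum_const,
      Finset.card_univ, nsmul_eq_mul, hβdef, inv_div, mul_div_cancel₀ _ hcard.ne'] at h1
    linarith

theorem sum_mul_exp_le_s9 {A : Type*} [Fintype A] {w : A → ℝ} (hw : IsDist w) {φ : A → ℝ}
    (hφ : ∀ a, |φ a| ≤ 1) {r : ℝ} (hr0 : 0 ≤ r) (hr1 : r ≤ 1) :
    ∑ a, w a * Real.exp (r * φ a) ≤ Real.exp (r * ∑ a, w a * φ a + r ^ 2) := by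
  have h1 : ∀ a, Real.exp (r * φ a) ≤ 1 + r * φ a + r ^ 2 := by
    intro a
    have h2 : |r * φ a| ≤ r := by
      rw [abs_mul, abs_of_nonneg hr0]
      exact mul_le_of_le_one_right hr0 (hφ a)
    have h3 := (abs_le.1 (Real.abs_exp_sub_one_sub_id_le (h2.trans hr1))).2
    have h4 : (r * φ a) ^ 2 ≤ r ^ 2 := by
      rw [← sq_abs (r * φ a)]
      gcongr
    linarith
  calc ∑ a, w a * Real.exp (r * φ a) ≤ ∑ a, w a * (1 + r * φ a + r ^ 2) :=
        Finset.sum_le_sum fun a _ => mul_le_mul_of_nonneg_left (h1 a) (hw.1 a)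
    _ = (r * ∑ a, w a * φ a + r ^ 2) + 1 := by
        have : ∀ a, w a * (1 + r * φ a + r ^ 2) = (1 + r ^ 2) * w a + r * (w a * φ a) :=
          fun a => by ring
        simp_rw [this]
        rw [Finset.sum_add_distrib, ← Finset.mul_sum, ← Finset.mul_sum, hw.2]
        ring
    _ ≤ _ := Real.add_one_le_exp _

/-- Exponential moment bound for the average of `φ` over all combinations of the samples. -/
theorem sum_mul_exp_average_le_s9 {I M T : Type*} [Fintype I] [DecidableEq I] [Fintype M]
    [Fintype T] [DecidableEq T] [AddGroup T] {x : I → M → ℝ} (hx0 : ∀ i j, 0 ≤ x i j)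
    (hx1 : ∀ i, ∑ j, x i j = 1) {φ : (I → M) → ℝ} (hφ : ∀ a, |φ a| ≤ 1) {r : ℝ} (hr0 : 0 ≤ r)
    (hr1 : r ≤ 1) :
    ∑ S : I → T → M, (∏ i, ∏ t, x i (S i t)) * Real.exp (r * (Fintype.card T *
        ∑ τ : I → T, (∏ _l : I, (Fintype.card T : ℝ)⁻¹) * φ fun i => S i (τ i))) ≤
      Real.exp (Fintype.card T * (r * ∑ a : I → M, (∏ l, x l (a l)) * φ a + r ^ 2)) := by
  have hT : (Fintype.card T : ℝ) ≠ 0 := by exact_mod_cast Fintype.card_ne_zero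
  set Q : ℝ := ∏ _l : I, (Fintype.card T : ℝ)⁻¹ with hQ
  have hQ0 : 0 ≤ Q := by positivity
  have hQ1 : ∑ _τ : I → T, Q = 1 := by
    refine sum_prod_eq_one (x := fun (_ : I) (_ : T) => (Fintype.card T : ℝ)⁻¹) fun i => ?_
    rw [Finset.sum_const, Finset.card_univ, nsmul_eq_mul, mul_inv_cancel₀ hT]
  have hshift : ∀ S : I → T → M, (Fintype.card T : ℝ) * ∑ τ : I → T, Q * φ (fun i => S i (τ i)) =
      ∑ τ : I → T, Q * ∑ t : T, φ fun i => S i (t + τ i) := by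
    intro S
    simp_rw [Finset.mul_sum (s := (univ : Finset T))]
    rw [Finset.sum_comm]
    have : ∀ t : T, ∑ τ : I → T, Q * φ (fun i => S i (t + τ i)) =
        ∑ τ : I → T, Q * φ (fun i => S i (τ i)) := fun t =>
      Equiv.sum_comp (Equiv.addLeft (fun _ : I => t)) fun τ : I → T => Q * φ (fun i => S i (τ i))
    simp_rw [this]
    rw [Finset.sum_const, Finset.card_univ, nsmul_eq_mul]
  have hP0 : ∀ S : I → T → M, 0 ≤ ∏ i, ∏ t, x i (S i t) := fun S =>
    Finset.prod_nonneg fun i _ => Finset.prod_nonneg fun t _ => hx0 _ _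
  have hjensen : ∀ S : I → T → M, Real.exp (r * (Fintype.card T *
      ∑ τ : I → T, Q * φ fun i => S i (τ i))) ≤
      ∑ τ : I → T, Q * ∏ t : T, Real.exp (r * φ fun i => S i (t + τ i)) := by
    intro S
    have h := convexOn_exp.map_sum_le (t := univ) (w := fun _ : I → T => Q)
      (p := fun τ => ∑ t : T, r * φ fun i => S i (t + τ i)) (fun _ _ => hQ0) hQ1
      (fun _ _ => Set.mem_univ _)
    simp only [smul_eq_mul] at h
    refine le_trans (le_of_eq ?_) (h.trans_eq (Finset.sum_congr rfl fun τ _ => by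
      rw [Real.exp_sum]))
    rw [hshift, Finset.mul_sum]
    refine congrArg Real.exp (Finset.sum_congr rfl fun τ _ => ?_)
    rw [← Finset.mul_sum]; ring
  have hτ : ∀ τ : I → T, ∑ S : I → T → M, (∏ i, ∏ t, x i (S i t)) *
      ∏ t : T, Real.exp (r * φ fun i => S i (t + τ i)) =
      (∑ a : I → M, (∏ i, x i (a i)) * Real.exp (r * φ a)) ^ Fintype.card T := by
    intro τ
    rw [← Finset.card_univ, ← Finset.prod_const, Finset.prod_univ_sum, Fintype.piFinset_univ]
    let e : (I → T → M) ≃ (T → I → M) :=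
      { toFun := fun S t i => S i (t + τ i)
        invFun := fun a i t => a (t - τ i) i
        left_inv := fun S => by ext; simp
        right_inv := fun a => by ext; simp }
    refine Fintype.sum_equiv e _ _ fun S => ?_
    rw [Finset.prod_mul_distrib, Finset.prod_comm (s := (univ : Finset T))]
    congr 1
    refine Finset.prod_congr rfl fun i _ => ?_
    exact (Equiv.prod_comp (Equiv.addRight (τ i)) fun t => x i (S i t)).symm
  have hdist : IsDist fun a : I → M => ∏ i, x i (a i) :=
    ⟨fun a => Finset.prod_nonneg fun i _ => hx0 _ _, sum_prod_eq_one hx1⟩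
  calc _ ≤ ∑ S : I → T → M, (∏ i, ∏ t, x i (S i t)) *
        ∑ τ : I → T, Q * ∏ t : T, Real.exp (r * φ fun i => S i (t + τ i)) :=
        Finset.sum_le_sum fun S _ => mul_le_mul_of_nonneg_left (hjensen S) (hP0 S)
    _ = ∑ τ : I → T, Q * ∑ S : I → T → M, (∏ i, ∏ t, x i (S i t)) *
        ∏ t : T, Real.exp (r * φ fun i => S i (t + τ i)) := by
        simp_rw [Finset.mul_sum]
        rw [Finset.sum_comm]
        refine Finset.sum_congr rfl fun τ _ => Finset.sum_congr rfl fun S _ => by ring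
    _ = (∑ a : I → M, (∏ i, x i (a i)) * Real.exp (r * φ a)) ^ Fintype.card T := by
        simp_rw [hτ]
        rw [← Finset.sum_mul, hQ1, one_mul]
    _ ≤ Real.exp (r * ∑ a : I → M, (∏ l, x l (a l)) * φ a + r ^ 2) ^ Fintype.card T := by
        refine pow_le_pow_left₀ (Finset.sum_nonneg fun a _ =>
          mul_nonneg (hdist.1 a) (Real.exp_pos _).le) ?_ _
        exact sum_mul_exp_le_s9 hdist hφ hr0 hr1
    _ = _ := by rw [← Real.exp_nat_mul]

/-- A product distribution can be replaced, factor by factor, by uniform distributions on small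
multisets without increasing any of few given bounded expectations by more than `δ`. -/
theorem exists_sparse_product {I M T ι : Type*} [Fintype I] [DecidableEq I] [Fintype M]
    [Fintype T] [DecidableEq T] [AddGroup T] [Fintype ι] {x : I → M → ℝ}
    (hx0 : ∀ i j, 0 ≤ x i j) (hx1 : ∀ i, ∑ j, x i j = 1) {φ : ι → (I → M) → ℝ}
    (hφ : ∀ c a, |φ c a| ≤ 1) {δ : ℝ} (hδ0 : 0 < δ) (hδ1 : δ ≤ 1)
    (hcard : Fintype.card ι * Real.exp (-(Fintype.card T * δ ^ 2 / 4)) < 1) :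
    ∃ S : I → T → M, ∀ c,
      ∑ τ : I → T, (∏ _l : I, (Fintype.card T : ℝ)⁻¹) * φ c (fun i => S i (τ i)) ≤
        ∑ a : I → M, (∏ l, x l (a l)) * φ c a + δ := by
  have hT : (0 : ℝ) < Fintype.card T := by exact_mod_cast Fintype.card_pos
  set Y : ι → (I → T → M) → ℝ := fun c S =>
    ∑ τ : I → T, (∏ _l : I, (Fintype.card T : ℝ)⁻¹) * φ c (fun i => S i (τ i)) with hY
  set μ : ι → ℝ := fun c => ∑ a : I → M, (∏ l, x l (a l)) * φ c a with hμ
  set P : (I → T → M) → ℝ := fun S => ∏ i, ∏ t, x i (S i t) with hP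
  have hP0 : ∀ S, 0 ≤ P S := fun S =>
    Finset.prod_nonneg fun i _ => Finset.prod_nonneg fun t _ => hx0 _ _
  have hP1 : ∑ S, P S = 1 :=
    sum_prod_eq_one (x := fun i (s : T → M) => ∏ t, x i (s t)) fun i =>
      sum_prod_eq_one (x := fun _ : T => x i) fun _ => hx1 i
  by_contra! hbad
  have h1 : ∀ S, 1 ≤ ∑ c, Real.exp (δ / 2 * (Fintype.card T * Y c S)) *
      Real.exp (-(Fintype.card T * (δ / 2 * (μ c + δ)))) := by
    intro S
    obtain ⟨c, hc⟩ := hbad S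
    refine le_trans ?_ (Finset.single_le_sum (f := fun c =>
      Real.exp (δ / 2 * (Fintype.card T * Y c S)) *
      Real.exp (-(Fintype.card T * (δ / 2 * (μ c + δ))))) (fun _ _ => by positivity) (mem_univ c))
    rw [← Real.exp_add]
    refine Real.one_le_exp ?_
    have : 0 ≤ Fintype.card T * (δ / 2) * (Y c S - (μ c + δ)) :=
      mul_nonneg (by positivity) (sub_nonneg.2 hc.le)
    linarith
  have h2 : ∀ c, (∑ S, P S * Real.exp (δ / 2 * (Fintype.card T * Y c S))) *
      Real.exp (-(Fintype.card T * (δ / 2 * (μ c + δ)))) ≤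
      Real.exp (-(Fintype.card T * δ ^ 2 / 4)) := by
    intro c
    refine (mul_le_mul_of_nonneg_right (sum_mul_exp_average_le_s9 hx0 hx1 (hφ c)
      (show 0 ≤ δ / 2 by linarith) (by linarith)) (Real.exp_pos _).le).trans ?_
    rw [← Real.exp_add]
    refine Real.exp_le_exp.2 (le_of_eq ?_)
    simp only [hμ]
    ring
  have h3 : (1 : ℝ) ≤ Fintype.card ι * Real.exp (-(Fintype.card T * δ ^ 2 / 4)) := by
    calc (1 : ℝ) = ∑ S, P S * 1 := by simp [hP1]
      _ ≤ ∑ S, P S * ∑ c, Real.exp (δ / 2 * (Fintype.card T * Y c S)) *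
          Real.exp (-(Fintype.card T * (δ / 2 * (μ c + δ)))) :=
          Finset.sum_le_sum fun S _ => mul_le_mul_of_nonneg_left (h1 S) (hP0 S)
      _ = ∑ c, (∑ S, P S * Real.exp (δ / 2 * (Fintype.card T * Y c S))) *
          Real.exp (-(Fintype.card T * (δ / 2 * (μ c + δ)))) := by
          simp_rw [Finset.mul_sum, Finset.sum_mul]
          rw [Finset.sum_comm]
          simp_rw [mul_assoc]
      _ ≤ ∑ _c : ι, Real.exp (-(Fintype.card T * δ ^ 2 / 4)) :=
          Finset.sum_le_sum fun c _ => h2 c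
      _ = _ := by rw [Finset.sum_const, Finset.card_univ, nsmul_eq_mul]
  linarith

end ProductDistributions

section EmpiricalDistributions

variable {A : Type*} [Fintype A] [DecidableEq A] {k : ℕ}

theorem sum_empJoint_mul (a : Fin k → A) (g : A → ℝ) :
    ∑ p, empJoint k a p * g p = ∑ t, (k : ℝ)⁻¹ * g (a t) := by
  have h : ∀ p, empJoint k a p * g p = ∑ t, if a t = p then (k : ℝ)⁻¹ * g p else 0 := by
    intro p
    rw [← Finset.sum_filter, Finset.sum_const, nsmul_eq_mul, empJoint]
    ring
  simp_rw [h]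
  rw [Finset.sum_comm]
  simp

theorem isDist_empJoint (hk : 0 < k) (a : Fin k → A) : IsDist (empJoint k a) := by
  refine ⟨fun p => div_nonneg (Nat.cast_nonneg _) (Nat.cast_nonneg _), ?_⟩
  have h := sum_empJoint_mul a fun _ => 1
  have hk' : (k : ℝ) ≠ 0 := by exact_mod_cast hk.ne'
  simpa [hk'] using h

theorem isKUniform_empJoint (a : Fin k → A) : IsKUniform k (empJoint k a) :=
  fun _ => ⟨_, rfl⟩

theorem card_support_empJoint_le (a : Fin k → A) :
    (univ.filter fun p => empJoint k a p ≠ 0).card ≤ k := by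
  have h : (univ.filter fun p => empJoint k a p ≠ 0) ⊆ univ.image a := by
    intro p hp
    by_contra hpa
    refine (Finset.mem_filter.1 hp).2 ?_
    have : (univ.filter fun t => a t = p) = ∅ :=
      Finset.filter_eq_empty_iff.2 fun t _ ht => hpa (Finset.mem_image.2 ⟨t, mem_univ t, ht⟩)
    simp [empJoint, this]
  exact (Finset.card_le_card h).trans (Finset.card_image_le.trans (by simp))

end EmpiricalDistributions

theorem mul_exp_neg_lt_one {N s : ℝ} (hN : 0 < N) (h : Real.log N < s) :
    N * Real.exp (-s) < 1 := by
  rw [Real.exp_neg, ← div_eq_mul_inv, div_lt_one (Real.exp_pos _)]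
  exact (Real.log_lt_iff_lt_exp hN).1 h

section Games

variable {n m : ℕ} {u : Fin n → (Fin n → Fin m) → ℝ}

/-- An approximate Nash equilibrium in which every player mixes uniformly over a multiset of `b`
actions. -/
theorem exists_uniform_approx_nash (hm : 0 < m) (hu : ∀ i a, 0 ≤ u i a ∧ u i a ≤ 1) {δ : ℝ}
    (hδ0 : 0 < δ) (hδ1 : δ ≤ 1) {b : ℕ} [NeZero b]
    (hb : ((n * (m + 1) : ℕ) : ℝ) * Real.exp (-(b * δ ^ 2 / 4)) < 1) :
    ∃ S : Fin n → Fin b → Fin m, ∀ i j,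
      ∑ τ : Fin n → Fin b, (∏ _l : Fin n, (b : ℝ)⁻¹) *
          u i (Function.update (fun l => S l (τ l)) i j) ≤
        ∑ τ : Fin n → Fin b, (∏ _l : Fin n, (b : ℝ)⁻¹) * u i (fun l => S l (τ l)) + 3 * δ := by
  have : NeZero m := ⟨hm.ne'⟩
  obtain ⟨x, hx0, hx1, hx⟩ := exists_approx_nash u hδ0
  obtain ⟨S, hS⟩ := exists_sparse_product (T := Fin b) (ι := Fin n × Option (Fin m)) hx0 hx1
    (φ := fun c a => c.2.elim (-u c.1 a) fun j => u c.1 (Function.update a c.1 j))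
    (by
      rintro ⟨i, _ | j⟩ a
      · simp only [Option.elim, abs_neg]
        exact abs_le.2 ⟨by linarith [(hu i a).1], (hu i a).2⟩
      · simp only [Option.elim]
        exact abs_le.2 ⟨by linarith [(hu i (Function.update a i j)).1], (hu i _).2⟩)
    hδ0 hδ1 (by simpa using hb)
  refine ⟨S, fun i j => ?_⟩
  have h1 := hS (i, some j)
  have h2 := hS (i, none)
  simp only [Option.elim, Fintype.card_fin, mul_neg, Finset.sum_neg_distrib] at h1 h2
  linarith [hx i j]

/-- In a product of uniform distributions over multisets that is an approximate Nash equilibrium,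
no deviation that depends on the own sample index is profitable. -/
theorem sum_index_deviation_le {b : ℕ} [NeZero b] {S : Fin n → Fin b → Fin m} {η : ℝ}
    {i : Fin n}
    (hS : ∀ j, ∑ τ : Fin n → Fin b, (∏ _l : Fin n, (b : ℝ)⁻¹) *
          u i (Function.update (fun l => S l (τ l)) i j) ≤
        ∑ τ : Fin n → Fin b, (∏ _l : Fin n, (b : ℝ)⁻¹) * u i (fun l => S l (τ l)) + η)
    (h : Fin b → Fin m) :
    ∑ τ : Fin n → Fin b, (∏ _l : Fin n, (b : ℝ)⁻¹) *
      (u i (Function.update (fun l => S l (τ l)) i (h (τ i))) - u i (fun l => S l (τ l))) ≤ η := by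
  have hb : (b : ℝ) ≠ 0 := by exact_mod_cast NeZero.ne b
  have hsum : ∑ _s : Fin b, (b : ℝ)⁻¹ = 1 := by simp [hb]
  have hupd : ∀ (τ : Fin n → Fin b) s,
      Function.update (fun l => S l (Function.update τ i s l)) i (h s) =
        Function.update (fun l => S l (τ l)) i (h s) := by
    intro τ s
    ext l
    by_cases hl : l = i
    · subst hl; simp
    · simp [hl]
  simp_rw [mul_sub]
  rw [Finset.sum_sub_distrib, sub_le_iff_le_add',
    sum_prod_mul_eq_sum_update (x := fun (_ : Fin n) (_ : Fin b) => (b : ℝ)⁻¹) (i := i) hsum]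
  simp only [Function.update_self, hupd]
  refine (Finset.sum_le_sum fun s _ =>
    mul_le_mul_of_nonneg_left (hS (h s)) (by positivity)).trans_eq ?_
  rw [← Finset.sum_mul, hsum, one_mul]

theorem exists_samples_isCE (hm : 0 < m) (hu : ∀ i a, 0 ≤ u i a ∧ u i a ≤ 1) {δ : ℝ}
    (hδ0 : 0 < δ) (hδ1 : δ ≤ 1) {b k : ℕ} [NeZero b] [NeZero k]
    (hb : ((n * (m + 1) : ℕ) : ℝ) * Real.exp (-(b * δ ^ 2 / 4)) < 1)
    (hk : ((n * m ^ b : ℕ) : ℝ) * Real.exp (-(k * δ ^ 2 / 4)) < 1) :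
    ∃ a : Fin k → Fin n → Fin m, IsCE u (empJoint k a) (4 * δ) := by
  obtain ⟨S, hS⟩ := exists_uniform_approx_nash hm hu hδ0 hδ1 hb
  have hb0 : (b : ℝ) ≠ 0 := by exact_mod_cast NeZero.ne b
  have hsum : ∑ _τ : Fin n → Fin b, ∏ _l : Fin n, (b : ℝ)⁻¹ = 1 :=
    sum_prod_eq_one (x := fun (_ : Fin n) (_ : Fin b) => (b : ℝ)⁻¹) fun _ => by simp [hb0]
  obtain ⟨σ, hσ⟩ := exists_sparse_product (I := Unit) (M := Fin n → Fin b) (T := Fin k)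
    (ι := Fin n × (Fin b → Fin m)) (x := fun _ _ => ∏ _l : Fin n, (b : ℝ)⁻¹)
    (φ := fun c s => u c.1 (Function.update (fun l => S l (s () l)) c.1 (c.2 (s () c.1))) -
      u c.1 (fun l => S l (s () l)))
    (fun _ _ => by positivity) (fun _ => hsum)
    (fun c s => abs_le.2 ⟨by
        linarith [(hu c.1 (fun l => S l (s () l))).2, (hu c.1
          (Function.update (fun l => S l (s () l)) c.1 (c.2 (s () c.1)))).1], by
        linarith [(hu c.1 (fun l => S l (s () l))).1, (hu c.1
          (Function.update (fun l => S l (s () l)) c.1 (c.2 (s () c.1)))).2]⟩)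
    hδ0 hδ1 (by simpa using hk)
  refine ⟨fun t l => S l (σ () t l), fun i f => ?_⟩
  rw [sum_empJoint_mul]
  have h1 := hσ (i, fun s => f (S i s))
  have h2 := sum_index_deviation_le (hS i) fun s => f (S i s)
  have h3 : ∀ (w : ℝ) {X : Type} [Fintype X] (g : X → ℝ),
      ∑ s : Unit → X, (∏ _l : Unit, w) * g (s ()) = ∑ t, w * g t := by
    intro w X _ g
    refine Fintype.sum_equiv (Equiv.funUnique Unit X) _ _ fun s => ?_
    simp
  simp only [Fintype.card_fin] at h1
  rw [h3 _ fun t => u i (Function.update (fun l => S l (σ () t l)) i (f (S i (σ () t i)))) -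
      u i (fun l => S l (σ () t l)),
    h3 _ fun τ : Fin n → Fin b => u i (Function.update (fun l => S l (τ l)) i (f (S i (τ i)))) -
      u i (fun l => S l (τ l))] at h1
  linarith

end Games

theorem exists_sample_size {n m k : ℕ} (hn : 0 < n) (hm : 2 ≤ m) {δ : ℝ} (hδ0 : 0 < δ)
    (hδ1 : δ ≤ 1)
    (hk : (k : ℝ) ≥ 49 / δ ^ 4 * Real.log m * (Real.log m + Real.log n)) :
    ∃ b : ℕ, 0 < b ∧ ((n * (m + 1) : ℕ) : ℝ) * Real.exp (-(b * δ ^ 2 / 4)) < 1 ∧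
      ((n * m ^ b : ℕ) : ℝ) * Real.exp (-(k * δ ^ 2 / 4)) < 1 := by
  have hn1 : (1 : ℝ) ≤ n := by exact_mod_cast hn
  have hm2 : (2 : ℝ) ≤ m := by exact_mod_cast hm
  have hn0 : (0 : ℝ) < n := by linarith
  have hm0 : (0 : ℝ) < m := by linarith
  set p := Real.log m with hp
  set q := Real.log n with hq
  have hq0 : 0 ≤ q := Real.log_nonneg hn1
  have hp0 : 1 / 2 < p := by
    have h1 : Real.log 2 ≤ p := Real.log_le_log two_pos hm2
    linarith [Real.log_two_gt_d9]
  have hm1 : Real.log (m + 1) ≤ 2 * p := by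
    rw [hp, ← Real.log_rpow hm0]
    refine Real.log_le_log (by linarith) ?_
    norm_cast
    nlinarith
  have hlog : Real.log ((n * (m + 1) : ℕ) : ℝ) = q + Real.log (m + 1) := by
    push_cast
    rw [Real.log_mul hn0.ne' (by positivity)]
  have hlog0 : 0 ≤ Real.log (m + 1) := Real.log_nonneg (by linarith)
  have hδ2 : 0 < δ ^ 2 := by positivity
  set B : ℝ := 4 * (q + Real.log (m + 1)) / δ ^ 2 with hB
  have hB0 : 0 ≤ B := by positivity
  refine ⟨⌊B⌋₊ + 1, Nat.succ_pos _, mul_exp_neg_lt_one (by positivity) ?_,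
    mul_exp_neg_lt_one (by positivity) ?_⟩
  · rw [hlog]
    have h1 : B < (⌊B⌋₊ + 1 : ℕ) := by push_cast; exact Nat.lt_floor_add_one B
    rw [hB, div_lt_iff₀ hδ2] at h1
    linarith
  · have hb1 : ((⌊B⌋₊ + 1 : ℕ) : ℝ) ≤ B + 1 := by
      push_cast
      linarith [Nat.floor_le hB0]
    generalize ⌊B⌋₊ + 1 = b at hb1
    have h1 : Real.log ((n * m ^ b : ℕ) : ℝ) = q + b * p := by
      push_cast
      rw [Real.log_mul hn0.ne' (by positivity), Real.log_pow]
    rw [h1]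
    have hsq : δ ^ 2 ≤ 1 := pow_le_one₀ hδ0.le hδ1
    have h2 : b * δ ^ 2 ≤ 10 * (p + q) := by
      have h3 : B * δ ^ 2 = 4 * (q + Real.log (m + 1)) := div_mul_cancel₀ _ hδ2.ne'
      have h4 : b * δ ^ 2 ≤ (B + 1) * δ ^ 2 := by gcongr
      linarith
    have h5 : 49 * p * (p + q) ≤ k * δ ^ 4 := by
      rw [ge_iff_le, div_mul_eq_mul_div, div_mul_eq_mul_div, div_le_iff₀ (by positivity)] at hk
      exact hk
    have h6 : b * δ ^ 2 * p ≤ 10 * (p + q) * p := by gcongr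
    have h7 : q * δ ^ 2 ≤ q := mul_le_of_le_one_right hq0 hsq
    have h8 : q ≤ 2 * p * (p + q) := by nlinarith
    have h9 : 0 < p * (p + q) := by positivity
    have h10 : (q + b * p) * δ ^ 2 < k * δ ^ 2 / 4 * δ ^ 2 := by
      have : k * δ ^ 2 / 4 * δ ^ 2 = k * δ ^ 4 / 4 := by ring
      rw [this]
      linarith
    exact lt_of_mul_lt_mul_right h10 hδ2.le

/-- For every `ε ∈ (0,1)` there is a constant `C = C(ε) > 0` such that
every `n`-player `m`-action game admits a `k`-uniform distribution on the action
profiles that is an `ε`-correlated equilibrium, for every positive integer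
`k ≥ C·ln m·(ln m + ln n)`; in particular such a distribution has support of size at
most `k = O(log m (log m + log n))`. -/
theorem stmt9 (ε : ℝ) (hε : 0 < ε ∧ ε < 1) :
    ∃ C > (0 : ℝ), ∀ (n m : ℕ), 0 < n → 0 < m →
      ∀ u : Fin n → (Fin n → Fin m) → ℝ, (∀ i a, 0 ≤ u i a ∧ u i a ≤ 1) →
      ∀ k : ℕ, 0 < k → (k : ℝ) ≥ C * Real.log m * (Real.log m + Real.log n) →
        ∃ x : (Fin n → Fin m) → ℝ, IsDist x ∧ IsKUniform k x ∧ IsCE u x ε ∧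
          (univ.filter fun a => x a ≠ 0).card ≤ k := by
  have hδ0 : 0 < ε / 4 := by linarith [hε.1]
  have hδ1 : ε / 4 ≤ 1 := by linarith [hε.2]
  refine ⟨49 / (ε / 4) ^ 4, by positivity, fun n m hn hm u hu k hk0 hk => ?_⟩
  have : NeZero k := ⟨hk0.ne'⟩
  suffices h : ∃ a : Fin k → Fin n → Fin m, IsCE u (empJoint k a) ε by
    obtain ⟨a, ha⟩ := h
    exact ⟨empJoint k a, isDist_empJoint hk0 a, isKUniform_empJoint a, ha,
      card_support_empJoint_le a⟩
  rcases Nat.lt_or_ge m 2 with hm2 | hm2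
  · obtain rfl : m = 1 := by omega
    refine ⟨fun _ _ => 0, fun i f => ?_⟩
    have : ∀ a : Fin n → Fin 1, Function.update a i (f (a i)) = a := fun a =>
      Subsingleton.elim _ _
    simp only [this, sub_self, mul_zero, Finset.sum_const_zero]
    exact hε.1.le
  · obtain ⟨b, hb0, hb, hkb⟩ := exists_sample_size hn hm2 hδ0 hδ1 hk
    have : NeZero b := ⟨hb0.ne'⟩
    have h := exists_samples_isCE hm hu hδ0 hδ1 hb hkb
    rwa [mul_div_cancel₀ ε four_ne_zero] at h
end
end
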